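/- Let Ω_β (β > π/2) be a worm domain. Then S(Ω_β) = π/(2(π − β)) if π/2 < β < π, and S(Ω_β) = ∞ if β ≥ π. -/

import Mathlib

noncomputable section

open Complex Topology
open scoped ENNReal

/-- Wirtinger derivative `∂f/∂z_j`. -/
def dz {n : ℕ} (j : Fin n) (f : (Fin n → ℂ) → ℂ) (z : Fin n → ℂ) : ℂ :=
  (fderiv ℝ f z (Pi.single j 1) - Complex.I * fderiv ℝ f z (Pi.single j Complex.I)) / 2

/-- Wirtinger derivative `∂f/∂z̄_j`. -/
def dzbar {n : ℕ} (j : Fin n) (f : (Fin n → ℂ) → ℂ) (z : Fin n → ℂ) : ℂ :=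
  (fderiv ℝ f z (Pi.single j 1) + Complex.I * fderiv ℝ f z (Pi.single j Complex.I)) / 2

/-- Complexification of a real-valued function. -/
def cplx {n : ℕ} (ρ : (Fin n → ℂ) → ℝ) : (Fin n → ℂ) → ℂ := fun z => (ρ z : ℂ)

/-- The Levi form `L_ρ(X,Y)(z) = Σ_{j,k} ∂²ρ/∂z_j∂z̄_k (z) X_j conj(Y_k)`. -/
def levi {n : ℕ} (ρ : (Fin n → ℂ) → ℝ) (X Y : Fin n → ℂ) (z : Fin n → ℂ) : ℂ :=
  ∑ j, ∑ k, dz j (fun w => dzbar k (cplx ρ) w) z * X j * (starRingEnd ℂ) (Y k)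

/-- `Xf = Σ_j X_j ∂f/∂z_j` for a (1,0) vector `X`. -/
def dirDeriv {n : ℕ} (X : Fin n → ℂ) (f : (Fin n → ℂ) → ℂ) (z : Fin n → ℂ) : ℂ :=
  ∑ j, X j * dz j f z

/-- `X̄f = Σ_j conj(X_j) ∂f/∂z̄_j`. -/
def dirDerivBar {n : ℕ} (X : Fin n → ℂ) (f : (Fin n → ℂ) → ℂ) (z : Fin n → ℂ) : ℂ :=
  ∑ j, (starRingEnd ℂ) (X j) * dzbar j f z

/-- Derivative of `f` along the (1,0) vector field `X`. -/
def fieldDeriv {n : ℕ} (X : (Fin n → ℂ) → (Fin n → ℂ)) (f : (Fin n → ℂ) → ℂ)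
    (z : Fin n → ℂ) : ℂ :=
  dirDeriv (X z) f z

/-- Euclidean norm of the real gradient of `ρ`. -/
def gradNorm {n : ℕ} (ρ : (Fin n → ℂ) → ℝ) (z : Fin n → ℂ) : ℝ :=
  Real.sqrt (∑ j, ((fderiv ℝ ρ z (Pi.single j 1)) ^ 2 +
    (fderiv ℝ ρ z (Pi.single j Complex.I)) ^ 2))

/-- The complex normal field `N_ρ`. -/
def nfield {n : ℕ} (ρ : (Fin n → ℂ) → ℝ) (z : Fin n → ℂ) : Fin n → ℂ := fun j =>
  ((Real.sqrt (∑ k, Complex.normSq (dz k (cplx ρ) z)) : ℝ) : ℂ)⁻¹ * dzbar j (cplx ρ) z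

/-- Squared Euclidean norm of a vector in ℂⁿ. -/
def enormSq {n : ℕ} (X : Fin n → ℂ) : ℝ := ∑ j, Complex.normSq (X j)

/-- `f` is strictly plurisubharmonic on `S`. -/
def StrictPSHOn {n : ℕ} (f : (Fin n → ℂ) → ℝ) (S : Set (Fin n → ℂ)) : Prop :=
  ∀ z ∈ S, ∀ X : Fin n → ℂ, X ≠ 0 → 0 < (levi f X X z).re

/-- `ρ` is a (global smooth) defining function of `Ω` on the neighborhood `V` of `cl Ω`. -/
structure IsDefFn {n : ℕ} (Ω V : Set (Fin n → ℂ)) (ρ : (Fin n → ℂ) → ℝ) : Prop where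
  isOpen : IsOpen V
  subset : closure Ω ⊆ V
  smooth : ContDiffOn ℝ (⊤ : ℕ∞) ρ V
  eq : Ω = {z ∈ V | ρ z < 0}
  grad_ne : ∀ z ∈ frontier Ω, fderiv ℝ ρ z ≠ 0

/-- The Levi form of `ρ` is positive semidefinite on complex tangent vectors at `z`. -/
def LeviPseudoconvexAt {n : ℕ} (ρ : (Fin n → ℂ) → ℝ) (z : Fin n → ℂ) : Prop :=
  ∀ X : Fin n → ℂ, dirDeriv X (cplx ρ) z = 0 → 0 ≤ (levi ρ X X z).re

/-- `Ω` is a (smoothly bounded, Levi) pseudoconvex domain. -/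
def IsPseudoconvex {n : ℕ} (Ω : Set (Fin n → ℂ)) : Prop :=
  ∃ (V : Set (Fin n → ℂ)) (ρ : (Fin n → ℂ) → ℝ), IsDefFn Ω V ρ ∧
    ∀ p ∈ frontier Ω, LeviPseudoconvexAt ρ p

/-- The set of Steinness exponents of `ρ`. -/
def steinExpSet {n : ℕ} (Ω : Set (Fin n → ℂ)) (ρ : (Fin n → ℂ) → ℝ) : Set ℝ :=
  {η : ℝ | 1 < η ∧ ∃ W : Set (Fin n → ℂ), IsOpen W ∧ frontier Ω ⊆ W ∧
    StrictPSHOn (fun z => ρ z ^ η) ((closure Ω)ᶜ ∩ W)}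

/-- The Steinness exponent `η̃_ρ` of a defining function `ρ` (`∞` if none exists). -/
def steinExp {n : ℕ} (Ω : Set (Fin n → ℂ)) (ρ : (Fin n → ℂ) → ℝ) : ℝ≥0∞ :=
  sInf (ENNReal.ofReal '' steinExpSet Ω ρ)

/-- The Steinness index `S(Ω)`. -/
def steinIndex {n : ℕ} (Ω : Set (Fin n → ℂ)) : ℝ≥0∞ :=
  ⨅ (V : Set (Fin n → ℂ)) (ρ : (Fin n → ℂ) → ℝ) (_ : IsDefFn Ω V ρ), steinExp Ω ρ

/-- The set of Diederich–Fornæss exponents of `ρ`. -/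
def dfExpSet {n : ℕ} (Ω : Set (Fin n → ℂ)) (ρ : (Fin n → ℂ) → ℝ) : Set ℝ :=
  {η : ℝ | 0 < η ∧ η < 1 ∧ StrictPSHOn (fun z => -((-ρ z) ^ η)) Ω}

/-- The Diederich–Fornæss exponent of `ρ` (`0` if no exponent exists). -/
def dfExp {n : ℕ} (Ω : Set (Fin n → ℂ)) (ρ : (Fin n → ℂ) → ℝ) : ℝ :=
  sSup (insert 0 (dfExpSet Ω ρ))

/-- The Diederich–Fornæss index `DF(Ω)`. -/
def dfIndex {n : ℕ} (Ω : Set (Fin n → ℂ)) : ℝ :=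
  sSup {t : ℝ | ∃ V ρ, IsDefFn Ω V ρ ∧ t = dfExp Ω ρ}

/-- `L` is a smooth (1,0) tangent vector field for `ρ` on `A`. -/
def IsTangentField {n : ℕ} (ρ : (Fin n → ℂ) → ℝ) (L : (Fin n → ℂ) → (Fin n → ℂ))
    (A : Set (Fin n → ℂ)) : Prop :=
  ContDiffOn ℝ (⊤ : ℕ∞) L A ∧ ∀ z ∈ A, dirDeriv (L z) (cplx ρ) z = 0

/-- The key differential inequality
`(1/(η₂−1))|L_ρ(L,N)|²/‖∇ρ‖² − (1/2)(N L_ρ(L,L))/‖∇ρ‖ ≤ 0` at `p`. -/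
def keyIneqAt {n : ℕ} (ρ : (Fin n → ℂ) → ℝ) (L : (Fin n → ℂ) → (Fin n → ℂ)) (η₂ : ℝ)
    (p : Fin n → ℂ) : Prop :=
  1 / (η₂ - 1) * Complex.normSq (levi ρ (L p) (nfield ρ p) p) / (gradNorm ρ p) ^ 2 -
    1 / 2 * (fieldDeriv (nfield ρ) (fun w => levi ρ (L w) (L w) w) p).re / gradNorm ρ p ≤ 0

/-- The strict version of the key differential inequality. -/
def strictKeyIneqAt {n : ℕ} (ρ : (Fin n → ℂ) → ℝ) (L : (Fin n → ℂ) → (Fin n → ℂ)) (η₂ : ℝ)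
    (p : Fin n → ℂ) : Prop :=
  1 / (η₂ - 1) * Complex.normSq (levi ρ (L p) (nfield ρ p) p) / (gradNorm ρ p) ^ 2 -
    1 / 2 * (fieldDeriv (nfield ρ) (fun w => levi ρ (L w) (L w) w) p).re / gradNorm ρ p < 0

/-- `cl Ω` has a strong Stein neighborhood basis. -/
def HasStrongSteinBasis {n : ℕ} (Ω : Set (Fin n → ℂ)) : Prop :=
  ∃ (V : Set (Fin n → ℂ)) (ρ : (Fin n → ℂ) → ℝ), IsDefFn Ω V ρ ∧ ∃ ε₀ : ℝ, 0 < ε₀ ∧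
    (∀ z ∈ V, 0 ≤ ρ z → ρ z < ε₀ → fderiv ℝ ρ z ≠ 0) ∧
    ∀ ε : ℝ, 0 ≤ ε → ε < ε₀ → ∀ z ∈ V, ρ z = ε → LeviPseudoconvexAt ρ z

/-- Vanishing order at `0` of a holomorphic function `ℂ → ℂ` (`∞` if all derivatives vanish). -/
def orderC (h : ℂ → ℂ) : ℕ∞ :=
  sInf ((fun k : ℕ => (k : ℕ∞)) '' {k : ℕ | iteratedDeriv k h 0 ≠ 0})

/-- Vanishing order at `0` of a real-valued function on `ℂ`. -/
def orderR (g : ℂ → ℝ) : ℕ∞ :=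
  sInf ((fun k : ℕ => (k : ℕ∞)) '' {k : ℕ | iteratedFDeriv ℝ k g 0 ≠ 0})

/-- `ν(γ)`: minimal vanishing order at `0` of the components of `γ − p`. -/
def curveOrder {n : ℕ} (γ : ℂ → Fin n → ℂ) (p : Fin n → ℂ) : ℕ∞ :=
  ⨅ j, orderC (fun t => γ t j - p j)

/-- `p` is a boundary point of finite D'Angelo 1-type (w.r.t. the defining function `ρ`). -/
def FiniteTypePt {n : ℕ} (ρ : (Fin n → ℂ) → ℝ) (p : Fin n → ℂ) : Prop :=
  ∃ M : ℕ, ∀ γ : ℂ → Fin n → ℂ, (∀ j, AnalyticAt ℂ (fun t => γ t j) 0) → γ 0 = p →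
    ¬ (∀ᶠ t in nhds (0 : ℂ), γ t = p) →
    orderR (fun t => ρ (γ t)) ≤ (M : ℕ∞) * curveOrder γ p

/-- The defining function of the worm domain:
`ρ(z,w) = |z − e^{i log|w|²}|² − (1 − φ(log|w|²))`. -/
def wormRho (φ : ℝ → ℝ) (p : Fin 2 → ℂ) : ℝ :=
  Complex.normSq (p 0 - Complex.exp (Complex.I * (Real.log (Complex.normSq (p 1)) : ℂ))) -
    (1 - φ (Real.log (Complex.normSq (p 1))))

/-- The Diederich–Fornæss worm domain `Ω_β` (associated to the cut-off `φ`). -/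
def wormDomain (φ : ℝ → ℝ) : Set (Fin 2 → ℂ) :=
  {p : Fin 2 → ℂ | p 1 ≠ 0 ∧ wormRho φ p < 0}

/-- The properties of the cut-off function `φ` in the definition of the worm domain. -/
structure IsWormFunction (φ : ℝ → ℝ) (β : ℝ) : Prop where
  smooth : ContDiff ℝ (⊤ : ℕ∞) φ
  nonneg : ∀ x, 0 ≤ φ x
  even : ∀ x, φ (-x) = φ x
  convex : ConvexOn ℝ Set.univ φ
  zeroSet : φ ⁻¹' {0} = Set.Icc (-(β - Real.pi / 2)) (β - Real.pi / 2)
  large : ∃ a > 0, ∀ x : ℝ, a < |x| → 1 < φ x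
  deriv_ne : ∀ x, φ x = 1 → deriv φ x ≠ 0

/-- `γ` has the first and second derivatives `a` and `b` at `0`. -/
def HasJet (γ : ℝ → ℝ) (a b : ℝ) : Prop :=
  ∃ γ' : ℝ → ℝ, (∀ᶠ s in 𝓝 (0 : ℝ), HasDerivAt γ (γ' s) s) ∧ HasDerivAt γ' b 0 ∧ γ' 0 = a

namespace HasJet

lemma hasDerivAt {γ : ℝ → ℝ} {a b : ℝ} (h : HasJet γ a b) : HasDerivAt γ a 0 := by
  obtain ⟨g, h1, -, rfl⟩ := h
  exact h1.self_of_nhds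

lemma unique {γ : ℝ → ℝ} {a b a' b' : ℝ} (h : HasJet γ a b) (h' : HasJet γ a' b') :
    a = a' ∧ b = b' := by
  refine ⟨h.hasDerivAt.unique h'.hasDerivAt, ?_⟩
  obtain ⟨g, h1, h2, -⟩ := h
  obtain ⟨g', h1', h2', -⟩ := h'
  refine h2.unique (h2'.congr_of_eventuallyEq ?_)
  filter_upwards [h1, h1'] with s hs hs' using hs.unique hs'

lemma affine (a b : ℝ) : HasJet (fun s => a + s * b) b 0 := by
  refine ⟨fun _ => b, Filter.Eventually.of_forall fun s => ?_, hasDerivAt_const _ _, rfl⟩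
  simpa using ((hasDerivAt_id s).mul_const b).const_add a

lemma add {γ δ : ℝ → ℝ} {a b c d : ℝ} (h : HasJet γ a b) (h' : HasJet δ c d) :
    HasJet (fun s => γ s + δ s) (a + c) (b + d) := by
  obtain ⟨g, h1, h2, rfl⟩ := h
  obtain ⟨g', h1', h2', rfl⟩ := h'
  refine ⟨fun s => g s + g' s, ?_, h2.add h2', rfl⟩
  filter_upwards [h1, h1'] with s hs hs' using hs.add hs'

lemma mul {γ δ : ℝ → ℝ} {a b c d : ℝ} (h : HasJet γ a b) (h' : HasJet δ c d) :
    HasJet (fun s => γ s * δ s) (a * δ 0 + γ 0 * c) (b * δ 0 + 2 * a * c + γ 0 * d) := by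
  have e1 := h.hasDerivAt
  have e2 := h'.hasDerivAt
  obtain ⟨g, h1, h2, rfl⟩ := h
  obtain ⟨g', h1', h2', rfl⟩ := h'
  refine ⟨fun s => g s * δ s + γ s * g' s, ?_, ?_, rfl⟩
  · filter_upwards [h1, h1'] with s hs hs' using hs.mul hs'
  · refine ((h2.mul e2).add (e1.mul h2')).congr_deriv ?_
    ring

lemma comp {g γ : ℝ → ℝ} {a b : ℝ} (hg : ContDiffAt ℝ 2 g (γ 0)) (h : HasJet γ a b) :
    HasJet (fun s => g (γ s)) (deriv g (γ 0) * a)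
      (deriv g (γ 0) * b + deriv (deriv g) (γ 0) * a ^ 2) := by
  have e1 := h.hasDerivAt
  obtain ⟨γ', h1, h2, rfl⟩ := h
  have hd : ContDiffAt ℝ 1 (deriv g) (γ 0) := by
    exact (hg.fderiv_right (m := 1) (by norm_num)).clm_apply contDiffAt_const
  refine ⟨fun s => deriv g (γ s) * γ' s, ?_, ?_, rfl⟩
  · have := e1.continuousAt.eventually
      ((hg.eventually (by simp)).mono fun x hx => hx.differentiableAt (by simp))
    filter_upwards [h1, this] with s hs hs' using hs'.hasDerivAt.comp s hs
  · have := ((hd.differentiableAt (by simp)).hasDerivAt.comp (0 : ℝ) e1).mul h2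
    refine this.congr_deriv ?_
    simp only [Function.comp_apply]
    ring

lemma nonpos_of_isLocalMax {γ : ℝ → ℝ} {a b : ℝ} (h : HasJet γ a b) (hm : IsLocalMax γ 0) :
    b ≤ 0 := by
  by_contra! hb
  have e1 := h.hasDerivAt
  have ha : deriv γ 0 = 0 := hm.deriv_eq_zero
  obtain ⟨g, h1, h2, rfl⟩ := h
  have hdd : deriv γ =ᶠ[𝓝 0] g := h1.mono fun s hs => hs.deriv
  have h3 : deriv (deriv γ) 0 = b := by rw [hdd.deriv_eq, h2.deriv]
  have hmin : IsLocalMin γ 0 :=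
    isLocalMin_of_deriv_deriv_pos (by rw [h3]; exact hb) ha e1.continuousAt
  have hc : γ =ᶠ[𝓝 0] fun _ => γ 0 := by
    filter_upwards [hm, hmin] with s hs hs' using le_antisymm hs hs'
  have : deriv (deriv γ) 0 = 0 := by
    rw [hc.deriv.deriv_eq]; simp
  rw [h3] at this
  exact hb.ne' this

end HasJet

lemma ContDiffAt.hasJet {E : Type*} [NormedAddCommGroup E] [NormedSpace ℝ E] {f : E → ℝ} {q : E}
    (hf : ContDiffAt ℝ 2 f q) (V : E) :
    HasJet (fun s : ℝ => f (q + s • V)) (fderiv ℝ f q V) (fderiv ℝ (fderiv ℝ f) q V V) := by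
  have hl : ∀ s : ℝ, HasDerivAt (fun s : ℝ => q + s • V) V s := fun s => by
    simpa using ((hasDerivAt_id s).smul_const V).const_add q
  refine ⟨fun s => fderiv ℝ f (q + s • V) V, ?_, ?_, by simp⟩
  · have hq : Filter.Tendsto (fun s : ℝ => q + s • V) (𝓝 0) (𝓝 q) := by
      have := (hl 0).continuousAt.tendsto
      simpa using this
    have := hq.eventually
      ((hf.eventually (by simp)).mono fun x hx => hx.differentiableAt (by simp))
    filter_upwards [this] with s hs
    exact HasFDerivAt.comp_hasDerivAt (f := fun s : ℝ => q + s • V) s hs.hasFDerivAt (hl s)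
  · have hd : DifferentiableAt ℝ (fderiv ℝ f) (q + (0 : ℝ) • V) := by
      simpa using (hf.fderiv_right (m := 1) (by norm_num)).differentiableAt (by simp)
    have h1 := HasFDerivAt.comp_hasDerivAt (f := fun s : ℝ => q + s • V) (0 : ℝ)
      hd.hasFDerivAt (hl 0)
    have := h1.clm_apply (hasDerivAt_const (0 : ℝ) V)
    simpa using this

/-- `d` is the derivative of `f` along the `(1,0)` vector `X` and `l` is the Levi form of `f`
on `X`, both taken at `q` and computed along the real lines spanned by `X` and `iX`. -/
def HasLevi (f : (Fin 2 → ℂ) → ℝ) (q X : Fin 2 → ℂ) (d : ℂ) (l : ℝ) : Prop :=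
  ∃ a₁ a₂ b₁ b₂ : ℝ, HasJet (fun s : ℝ => f (q + s • X)) a₁ a₂ ∧
    HasJet (fun s : ℝ => f (q + s • (Complex.I • X))) b₁ b₂ ∧
    d = (a₁ - Complex.I * b₁) / 2 ∧ l = (a₂ + b₂) / 4

namespace HasLevi

variable {f g : (Fin 2 → ℂ) → ℝ} {q X : Fin 2 → ℂ} {d e : ℂ} {l m : ℝ}

lemma congr (h : HasLevi f q X d l) (hd : d = e) (hl : l = m) : HasLevi f q X e m := by
  subst hd hl; exact h

lemma re_coord (q X : Fin 2 → ℂ) (j : Fin 2) : HasLevi (fun q => (q j).re) q X (X j / 2) 0 := by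
  refine ⟨(X j).re, 0, -(X j).im, 0, ?_, ?_, ?_, ?_⟩
  · simpa using HasJet.affine (q j).re (X j).re
  · simpa using HasJet.affine (q j).re (-(X j).im)
  · apply Complex.ext <;> simp
  · simp

lemma im_coord (q X : Fin 2 → ℂ) (j : Fin 2) :
    HasLevi (fun q => (q j).im) q X (-Complex.I * X j / 2) 0 := by
  refine ⟨(X j).im, 0, (X j).re, 0, ?_, ?_, ?_, ?_⟩
  · simpa using HasJet.affine (q j).im (X j).im
  · simpa using HasJet.affine (q j).im (X j).re
  · apply Complex.ext <;> simp
  · simp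

lemma const (c : ℝ) (q X : Fin 2 → ℂ) : HasLevi (fun _ => c) q X 0 0 := by
  refine ⟨0, 0, 0, 0, ?_, ?_, ?_, ?_⟩
  · simpa using HasJet.affine c 0
  · simpa using HasJet.affine c 0
  · simp
  · simp

lemma add (h : HasLevi f q X d l) (h' : HasLevi g q X e m) :
    HasLevi (fun q => f q + g q) q X (d + e) (l + m) := by
  obtain ⟨a₁, a₂, b₁, b₂, ha, hb, rfl, rfl⟩ := h
  obtain ⟨c₁, c₂, e₁, e₂, hc, he, rfl, rfl⟩ := h'
  refine ⟨_, _, _, _, ha.add hc, hb.add he, ?_, ?_⟩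
  · push_cast; ring
  · ring

lemma mul (h : HasLevi f q X d l) (h' : HasLevi g q X e m) :
    HasLevi (fun q => f q * g q) q X (d * g q + f q * e)
      (l * g q + 2 * (d * (starRingEnd ℂ) e).re + f q * m) := by
  obtain ⟨a₁, a₂, b₁, b₂, ha, hb, rfl, rfl⟩ := h
  obtain ⟨c₁, c₂, e₁, e₂, hc, he, rfl, rfl⟩ := h'
  refine ⟨_, _, _, _, ha.mul hc, hb.mul he, ?_, ?_⟩
  · simp; ring
  · simp [Complex.div_re, Complex.div_im, Complex.normSq_apply]; ring

lemma comp {u : ℝ → ℝ} (hu : ContDiffAt ℝ 2 u (f q)) (h : HasLevi f q X d l) :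
    HasLevi (fun q => u (f q)) q X (deriv u (f q) * d)
      (deriv u (f q) * l + deriv (deriv u) (f q) * Complex.normSq d) := by
  obtain ⟨a₁, a₂, b₁, b₂, ha, hb, rfl, rfl⟩ := h
  refine ⟨_, _, _, _, HasJet.comp (g := u) (by simpa using hu) ha,
    HasJet.comp (g := u) (by simpa using hu) hb, ?_, ?_⟩
  · simp; ring
  · simp [Complex.normSq_apply]; ring

lemma neg (h : HasLevi f q X d l) : HasLevi (fun q => -f q) q X (-d) (-l) := by
  have := (const (-1) q X).mul h
  simpa using this

lemma fderiv_eq (h : HasLevi f q X d l) (hf : ContDiffAt ℝ 2 f q) :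
    fderiv ℝ f q X = 2 * d.re := by
  obtain ⟨a₁, a₂, b₁, b₂, ha, hb, rfl, rfl⟩ := h
  rw [((hf.hasJet X).unique ha).1]
  simp
  ring

lemma second_eq (h : HasLevi f q X d l) (hf : ContDiffAt ℝ 2 f q) :
    fderiv ℝ (fderiv ℝ f) q X X +
      fderiv ℝ (fderiv ℝ f) q (Complex.I • X) (Complex.I • X) = 4 * l := by
  obtain ⟨a₁, a₂, b₁, b₂, ha, hb, rfl, rfl⟩ := h
  rw [((hf.hasJet X).unique ha).2, ((hf.hasJet (Complex.I • X)).unique hb).2]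
  ring

end HasLevi

lemma fderiv_cplx {n : ℕ} {f : (Fin n → ℂ) → ℝ} {q : Fin n → ℂ} (hf : DifferentiableAt ℝ f q)
    (V : Fin n → ℂ) : fderiv ℝ (cplx f) q V = (fderiv ℝ f q V : ℂ) := by
  have h := Complex.ofRealCLM.hasFDerivAt.comp q hf.hasFDerivAt
  have h' : HasFDerivAt (cplx f) (Complex.ofRealCLM.comp (fderiv ℝ f q)) q := h
  rw [h'.fderiv]
  simp

lemma dz_dzbar_eq {n : ℕ} {f : (Fin n → ℂ) → ℝ} {q : Fin n → ℂ} (hf : ContDiffAt ℝ 2 f q)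
    (j k : Fin n) :
    dz j (fun w => dzbar k (cplx f) w) q =
      ((fderiv ℝ (fderiv ℝ f) q (Pi.single j 1) (Pi.single k 1) +
        fderiv ℝ (fderiv ℝ f) q (Pi.single j Complex.I) (Pi.single k Complex.I) : ℝ) +
      Complex.I * (fderiv ℝ (fderiv ℝ f) q (Pi.single j 1) (Pi.single k Complex.I) -
        fderiv ℝ (fderiv ℝ f) q (Pi.single j Complex.I) (Pi.single k 1) : ℝ)) / 4 := by
  have hd : DifferentiableAt ℝ (fderiv ℝ f) q :=
    (hf.fderiv_right (m := 1) (by norm_num)).differentiableAt (by simp)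
  have key : ∀ V : Fin n → ℂ, HasFDerivAt (fun w => ((fderiv ℝ f w V : ℝ) : ℂ))
      (Complex.ofRealCLM.comp ((fderiv ℝ (fderiv ℝ f) q).flip V)) q := by
    intro V
    have h := hd.hasFDerivAt.clm_apply (hasFDerivAt_const V q)
    have h2 := Complex.ofRealCLM.hasFDerivAt.comp q h
    refine h2.congr_fderiv ?_
    ext W
    simp
  have he : (fun w => dzbar k (cplx f) w) =ᶠ[𝓝 q] fun w =>
      (2⁻¹ : ℂ) * (((fderiv ℝ f w (Pi.single k 1) : ℝ) : ℂ) +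
        Complex.I * ((fderiv ℝ f w (Pi.single k Complex.I) : ℝ) : ℂ)) := by
    filter_upwards [hf.eventually (by simp)] with w hw
    have hw' := hw.differentiableAt (by simp)
    rw [dzbar, fderiv_cplx hw', fderiv_cplx hw']
    ring
  have h := (((key (Pi.single k 1)).add ((key (Pi.single k Complex.I)).const_mul
    Complex.I)).const_mul (2⁻¹ : ℂ)).congr_of_eventuallyEq he
  rw [dz, h.fderiv]
  simp
  ring_nf
  simp
  ring

lemma fin_two_expand (X : Fin 2 → ℂ) :
    X = (X 0).re • (Pi.single 0 1 : Fin 2 → ℂ) + (X 0).im • (Pi.single 0 Complex.I : Fin 2 → ℂ) +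
      (X 1).re • (Pi.single 1 1 : Fin 2 → ℂ) + (X 1).im • (Pi.single 1 Complex.I : Fin 2 → ℂ) := by
  ext j
  fin_cases j <;> simp [Complex.re_add_im]

lemma fin_two_I_smul_expand (X : Fin 2 → ℂ) :
    Complex.I • X = (-(X 0).im) • (Pi.single 0 1 : Fin 2 → ℂ) + (X 0).re • (Pi.single 0 Complex.I : Fin 2 → ℂ) +
      (-(X 1).im) • (Pi.single 1 1 : Fin 2 → ℂ) + (X 1).re • (Pi.single 1 Complex.I : Fin 2 → ℂ) := by
  ext j
  fin_cases j <;> apply Complex.ext <;> simp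

/-- The real part of the Levi form as an average of two real second derivatives. -/
lemma four_mul_levi_re {f : (Fin 2 → ℂ) → ℝ} {q : Fin 2 → ℂ} (hf : ContDiffAt ℝ 2 f q)
    (X : Fin 2 → ℂ) :
    4 * (levi f X X q).re = fderiv ℝ (fderiv ℝ f) q X X +
      fderiv ℝ (fderiv ℝ f) q (Complex.I • X) (Complex.I • X) := by
  have hsymm : ∀ V W, fderiv ℝ (fderiv ℝ f) q V W = fderiv ℝ (fderiv ℝ f) q W V := fun V W =>
    (hf.isSymmSndFDerivAt (by simp)).eq V W
  rw [fin_two_I_smul_expand X]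
  conv_rhs => enter [1]; rw [fin_two_expand X]
  simp only [levi, Fin.sum_univ_two, dz_dzbar_eq hf]
  simp only [map_add, map_smul, add_apply, smul_apply,
    smul_eq_mul, Fin.isValue]
  set H := fderiv ℝ (fderiv ℝ f) q
  rw [hsymm (Pi.single 0 Complex.I) (Pi.single 0 1), hsymm (Pi.single 1 1) (Pi.single 0 1),
    hsymm (Pi.single 1 1) (Pi.single 0 Complex.I), hsymm (Pi.single 1 Complex.I) (Pi.single 0 1),
    hsymm (Pi.single 1 Complex.I) (Pi.single 0 Complex.I),
    hsymm (Pi.single 1 Complex.I) (Pi.single 1 1)]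
  simp
  ring

lemma HasLevi.levi_re {f : (Fin 2 → ℂ) → ℝ} {q X : Fin 2 → ℂ} {d : ℂ} {l : ℝ}
    (h : HasLevi f q X d l) (hf : ContDiffAt ℝ 2 f q) : (levi f X X q).re = l := by
  have h1 := four_mul_levi_re hf X
  rw [h.second_eq hf] at h1
  linarith

/-- The angular variable `log|w|²` of the worm domain. -/
def wormAngle (q : Fin 2 → ℂ) : ℝ := Real.log (Complex.normSq (q 1))

/-- The coordinate `z e^{-i log|w|²} - 1`. -/
def wormRot (q : Fin 2 → ℂ) : ℂ := q 0 * Complex.exp (-Complex.I * wormAngle q) - 1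

lemma hasLevi_wormAngle {q : Fin 2 → ℂ} (hq : q 1 ≠ 0) (X : Fin 2 → ℂ) :
    HasLevi wormAngle q X (X 1 / q 1) 0 := by
  have hn : Complex.normSq (q 1) ≠ 0 := by simpa using hq
  have h := HasLevi.comp (u := Real.log) (Real.contDiffAt_log.2 (by
      simpa [Complex.normSq_apply] using hn))
    (((HasLevi.re_coord q X 1).mul (HasLevi.re_coord q X 1)).add
      ((HasLevi.im_coord q X 1).mul (HasLevi.im_coord q X 1)))
  have hf : (fun q : Fin 2 → ℂ => Real.log ((q 1).re * (q 1).re + (q 1).im * (q 1).im)) =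
      wormAngle := by
    ext q; simp [wormAngle, Complex.normSq_apply]
  have hdd : deriv (deriv Real.log) (Complex.normSq (q 1)) = -(Complex.normSq (q 1) ^ 2)⁻¹ := by
    rw [Real.deriv_log', deriv_inv]
  rw [hf] at h
  rw [← Complex.normSq_apply] at h
  refine h.congr ?_ ?_
  · rw [Real.deriv_log]
    apply Complex.ext <;> simp [Complex.div_re, Complex.div_im] <;> ring
  · rw [hdd, Real.deriv_log]
    field_simp
    simp [Complex.normSq_apply, Complex.div_re, Complex.div_im]
    ring

lemma exp_I_mul_eq (t : ℝ) : Complex.exp (Complex.I * t) = ⟨Real.cos t, Real.sin t⟩ := by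
  rw [mul_comm, Complex.exp_mul_I]
  apply Complex.ext <;> simp [Complex.cos_ofReal_re, Complex.sin_ofReal_re]

lemma exp_neg_I_mul_eq (t : ℝ) : Complex.exp (-Complex.I * t) = ⟨Real.cos t, -Real.sin t⟩ := by
  have := exp_I_mul_eq (-t)
  rw [Real.cos_neg, Real.sin_neg] at this
  rw [← this]
  congr 1
  push_cast
  ring

lemma eq_mul_exp (z : ℂ) (t : ℝ) :
    z = z * Complex.exp (-Complex.I * t) * Complex.exp (Complex.I * t) := by
  rw [mul_assoc, ← Complex.exp_add]; simp

lemma wormRho_eq (φ : ℝ → ℝ) (q : Fin 2 → ℂ) : wormRho φ q =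
    ((q 0).re - Real.cos (wormAngle q)) * ((q 0).re - Real.cos (wormAngle q)) +
    ((q 0).im - Real.sin (wormAngle q)) * ((q 0).im - Real.sin (wormAngle q)) +
      (-1 + φ (wormAngle q)) := by
  unfold wormRho
  rw [exp_I_mul_eq, Complex.normSq_apply]
  simp only [Complex.sub_re, Complex.sub_im, wormAngle]
  ring

lemma wormRho_eq_rot (φ : ℝ → ℝ) (q : Fin 2 → ℂ) : wormRho φ q =
    Complex.normSq (wormRot q) - 1 + φ (wormAngle q) := by
  have h : wormRot q = (q 0 - Complex.exp (Complex.I * wormAngle q)) *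
      Complex.exp (-Complex.I * wormAngle q) := by
    rw [wormRot, sub_mul, ← Complex.exp_add]; simp
  have h2 : Complex.normSq (Complex.exp (-Complex.I * wormAngle q)) = 1 := by
    rw [exp_neg_I_mul_eq, Complex.normSq_apply]
    have := Real.cos_sq_add_sin_sq (wormAngle q)
    simp only
    nlinarith
  rw [h, Complex.normSq_mul, h2]
  simp only [wormRho, wormAngle]
  ring

lemma hasLevi_cos_wormAngle {q : Fin 2 → ℂ} (hq : q 1 ≠ 0) (X : Fin 2 → ℂ) :
    HasLevi (fun q => Real.cos (wormAngle q)) q X (-Real.sin (wormAngle q) * (X 1 / q 1))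
      (-Real.cos (wormAngle q) * Complex.normSq (X 1 / q 1)) := by
  have h := (hasLevi_wormAngle hq X).comp (u := Real.cos) Real.contDiff_cos.contDiffAt
  refine h.congr ?_ ?_ <;> simp

lemma hasLevi_sin_wormAngle {q : Fin 2 → ℂ} (hq : q 1 ≠ 0) (X : Fin 2 → ℂ) :
    HasLevi (fun q => Real.sin (wormAngle q)) q X (Real.cos (wormAngle q) * (X 1 / q 1))
      (-Real.sin (wormAngle q) * Complex.normSq (X 1 / q 1)) := by
  have h := (hasLevi_wormAngle hq X).comp (u := Real.sin) Real.contDiff_sin.contDiffAt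
  refine h.congr ?_ ?_ <;> simp

lemma hasLevi_wormRho {φ : ℝ → ℝ} (hφ : ContDiff ℝ 2 φ) {q : Fin 2 → ℂ} (hq : q 1 ≠ 0)
    {X : Fin 2 → ℂ} {y E n : ℂ} (hy : X 1 / q 1 = y) (hn : wormRot q = n)
    (hE : X 0 * Complex.exp (-Complex.I * wormAngle q) = E + Complex.I * y) :
    HasLevi (wormRho φ) q X
      (E * (starRingEnd ℂ) n + y * (deriv φ (wormAngle q) + Complex.I * n))
      (Complex.normSq E + Complex.normSq y * (deriv (deriv φ) (wormAngle q) + 2 * n.re + 1)) := by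
  have hc := hasLevi_cos_wormAngle hq X
  have hs := hasLevi_sin_wormAngle hq X
  have h1 := (HasLevi.re_coord q X 0).add hc.neg
  have h2 := (HasLevi.im_coord q X 0).add hs.neg
  have h3 := (HasLevi.const (-1) q X).add
    ((hasLevi_wormAngle hq X).comp (u := φ) hφ.contDiffAt)
  have h := ((h1.mul h1).add (h2.mul h2)).add h3
  have hf : wormRho φ = _ := funext (wormRho_eq φ)
  rw [hf]
  simp only [sub_eq_add_neg]
  have hX : X 0 = (E + Complex.I * y) * Complex.exp (Complex.I * wormAngle q) := by
    rw [← hE]; exact eq_mul_exp _ _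
  have hz : q 0 = (n + 1) * Complex.exp (Complex.I * wormAngle q) := by
    rw [← hn, wormRot, sub_add_cancel]; exact eq_mul_exp _ _
  rw [hy] at h
  have hcs := Real.cos_sq_add_sin_sq (wormAngle q)
  rw [exp_I_mul_eq] at hX hz
  rw [hX, hz] at h
  generalize hC : Real.cos (wormAngle q) = C at *
  generalize hS : Real.sin (wormAngle q) = S at *
  have hS2 : S ^ 2 = 1 - C ^ 2 := by linarith
  refine h.congr ?_ ?_
  · apply Complex.ext
    · simp
      ring_nf
      simp only [hS2]
      ring
    · simp
      ring_nf
      simp only [hS2]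
      ring
  · simp [Complex.normSq_apply, Complex.div_re, Complex.div_im]
    ring_nf
    simp only [hS2]
    ring

lemma deriv_exp_comp {g : ℝ → ℝ} {t : ℝ} (hg : ContDiffAt ℝ 2 g t) :
    deriv (fun t => Real.exp (g t)) t = Real.exp (g t) * deriv g t ∧
    deriv (deriv fun t => Real.exp (g t)) t =
      Real.exp (g t) * (deriv (deriv g) t + deriv g t ^ 2) := by
  have h1 : ∀ᶠ x in 𝓝 t, deriv (fun t => Real.exp (g t)) x = Real.exp (g x) * deriv g x := by
    filter_upwards [hg.eventually (by simp)] with x hx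
    exact (hx.differentiableAt (by simp)).hasDerivAt.exp.deriv
  refine ⟨h1.self_of_nhds, ?_⟩
  have hd : HasDerivAt (deriv g) (deriv (deriv g) t) t :=
    ((hg.derivWithin (m := 1) (by norm_num)).differentiableAt (by simp)).hasDerivAt
  rw [Filter.EventuallyEq.deriv_eq h1]
  refine (((hg.differentiableAt (by simp)).hasDerivAt.exp.fun_mul hd).deriv).trans ?_
  ring

lemma deriv_deriv_rpow {x η : ℝ} (hx : 0 < x) :
    deriv (deriv fun x : ℝ => x ^ η) x = η * (η - 1) * x ^ (η - 2) := by
  have h1 : ∀ᶠ x in 𝓝 x, deriv (fun x : ℝ => x ^ η) x = η * x ^ (η - 1) := by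
    filter_upwards [lt_mem_nhds hx] with y hy
    exact (Real.hasDerivAt_rpow_const (Or.inl hy.ne')).deriv
  rw [Filter.EventuallyEq.deriv_eq h1,
    ((Real.hasDerivAt_rpow_const (Or.inl hx.ne')).const_mul η).deriv]
  ring_nf

lemma HasLevi.mul_exp {f : (Fin 2 → ℂ) → ℝ} {g : ℝ → ℝ} {q X : Fin 2 → ℂ} {d : ℂ} {l : ℝ}
    (h : HasLevi f q X d l) (hq : q 1 ≠ 0) (hg : ContDiffAt ℝ 2 g (wormAngle q)) :
    HasLevi (fun q => f q * Real.exp (g (wormAngle q))) q X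
      (Real.exp (g (wormAngle q)) * (d + f q * deriv g (wormAngle q) * (X 1 / q 1)))
      (Real.exp (g (wormAngle q)) * (l +
        2 * deriv g (wormAngle q) * (d * (starRingEnd ℂ) (X 1 / q 1)).re +
        f q * (deriv (deriv g) (wormAngle q) + deriv g (wormAngle q) ^ 2) *
          Complex.normSq (X 1 / q 1))) := by
  have h1 := (hasLevi_wormAngle hq X).comp (u := fun t => Real.exp (g t)) hg.exp
  rw [(deriv_exp_comp hg).1, (deriv_exp_comp hg).2] at h1
  refine (h.mul h1).congr ?_ ?_
  · push_cast; ring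
  · simp only [map_mul, Complex.conj_ofReal, mul_zero, zero_add]
    generalize (starRingEnd ℂ) (X 1 / q 1) = Y
    generalize Real.exp (g (wormAngle q)) = G
    simp
    ring

/-- The Levi form of `(f e^g)^η` where `g` is a function of `log|w|²`. -/
lemma HasLevi.mul_exp_rpow {f : (Fin 2 → ℂ) → ℝ} {g : ℝ → ℝ} {q X : Fin 2 → ℂ} {d : ℂ} {l : ℝ}
    (h : HasLevi f q X d l) (hq : q 1 ≠ 0) (hg : ContDiffAt ℝ 2 g (wormAngle q)) (hf : 0 < f q)
    (η : ℝ) : ∃ d', HasLevi (fun q => (f q * Real.exp (g (wormAngle q))) ^ η) q X d'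
      (η * (f q * Real.exp (g (wormAngle q))) ^ (η - 2) * Real.exp (g (wormAngle q)) ^ 2 *
        (f q * l + 2 * η * f q * deriv g (wormAngle q) * (d * (starRingEnd ℂ) (X 1 / q 1)).re +
          f q ^ 2 * (deriv (deriv g) (wormAngle q) + η * deriv g (wormAngle q) ^ 2) *
            Complex.normSq (X 1 / q 1) + (η - 1) * Complex.normSq d)) := by
  have hpos : 0 < f q * Real.exp (g (wormAngle q)) := mul_pos hf (Real.exp_pos _)
  have h1 := (h.mul_exp hq hg).comp (u := fun x : ℝ => x ^ η)
    (Real.contDiffAt_rpow_const_of_ne hpos.ne')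
  rw [deriv_deriv_rpow hpos, (Real.hasDerivAt_rpow_const (Or.inl hpos.ne')).deriv] at h1
  have e : (f q * Real.exp (g (wormAngle q))) ^ (η - 1) =
      (f q * Real.exp (g (wormAngle q))) ^ (η - 2) * (f q * Real.exp (g (wormAngle q))) := by
    rw [← Real.rpow_add_one hpos.ne']; ring_nf
  rw [e] at h1
  refine ⟨_, h1.congr rfl ?_⟩
  generalize (f q * Real.exp (g (wormAngle q))) ^ (η - 2) = P
  generalize X 1 / q 1 = y
  generalize Real.exp (g (wormAngle q)) = G
  simp [Complex.normSq_apply]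
  ring

/-- Positivity of a Hermitian form in two variables. -/
lemma hermitian_pos {A C : ℝ} {B E y : ℂ} (hA : 0 < A) (hdet : Complex.normSq B < A * C)
    (hne : E ≠ 0 ∨ y ≠ 0) :
    0 < A * Complex.normSq E + 2 * (E * (starRingEnd ℂ) y * B).re + C * Complex.normSq y := by
  have h1 : A * (A * Complex.normSq E + 2 * (E * (starRingEnd ℂ) y * B).re +
      C * Complex.normSq y) = Complex.normSq (A * E + y * (starRingEnd ℂ) B) +
      (A * C - Complex.normSq B) * Complex.normSq y := by
    simp [Complex.normSq_apply]; ring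
  have h2 : 0 < A * (A * Complex.normSq E + 2 * (E * (starRingEnd ℂ) y * B).re +
      C * Complex.normSq y) := by
    rw [h1]
    by_cases hy : y = 0
    · subst hy
      have hE : E ≠ 0 := by simpa using hne
      have : 0 < Complex.normSq (A * E) := by
        rw [Complex.normSq_pos]; simp [hE, hA.ne']
      simpa using this
    · have := mul_pos (sub_pos.2 hdet) (Complex.normSq_pos.2 hy)
      linarith [Complex.normSq_nonneg (A * E + y * (starRingEnd ℂ) B)]
  exact pos_of_mul_pos_right h2 hA.le

/-- The determinant condition for the Levi form of `(r e^g)^η`, where `r` is the defining function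
of the worm domain, in terms of `n = z e^{-it} - 1`, `r`, `φ', φ''` and `g', g''`. -/
def wormDet (η : ℝ) (n : ℂ) (r p₁ p₂ g₁ g₂ : ℝ) : ℝ :=
  Complex.normSq n * (p₂ + 2 * n.re + 2) + p₁ ^ 2 - 2 * p₁ * n.im +
    r / (η - 1) * (p₂ + 2 * n.re + 1 + r * (g₂ + η * g₁ ^ 2) + 2 * η * g₁ * (p₁ - n.im) -
      η ^ 2 * g₁ ^ 2 * Complex.normSq n + (η - 1) * Complex.normSq n * (g₂ + η * g₁ ^ 2))

lemma wormForm_pos {η r p₁ p₂ g₁ g₂ : ℝ} {n E y : ℂ} (hη : 1 < η) (hr : 0 < r)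
    (hdet : 0 < wormDet η n r p₁ p₂ g₁ g₂) (hne : E ≠ 0 ∨ y ≠ 0) :
    0 < r * (Complex.normSq E + Complex.normSq y * (p₂ + 2 * n.re + 1)) +
      2 * η * r * g₁ * ((E * (starRingEnd ℂ) n + y * (p₁ + Complex.I * n)) *
        (starRingEnd ℂ) y).re +
      r ^ 2 * (g₂ + η * g₁ ^ 2) * Complex.normSq y +
      (η - 1) * Complex.normSq (E * (starRingEnd ℂ) n + y * (p₁ + Complex.I * n)) := by
  have h1 : 0 < η - 1 := by linarith
  have hA : 0 < r + (η - 1) * Complex.normSq n := by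
    have := mul_nonneg h1.le (Complex.normSq_nonneg n); linarith
  set B : ℂ := (η - 1) * (starRingEnd ℂ) n * (starRingEnd ℂ) (p₁ + Complex.I * n) +
    r * η * g₁ * (starRingEnd ℂ) n with hB
  set C : ℝ := r * (p₂ + 2 * n.re + 1) + (η - 1) * Complex.normSq (p₁ + Complex.I * n) +
    2 * r * η * g₁ * (p₁ - n.im) + r ^ 2 * (g₂ + η * g₁ ^ 2) with hC
  have key : (r + (η - 1) * Complex.normSq n) * C - Complex.normSq B =
      r * (η - 1) * wormDet η n r p₁ p₂ g₁ g₂ := by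
    rw [hB, hC, wormDet]
    field_simp
    simp [Complex.normSq_apply]
    ring
  have hlt : Complex.normSq B < (r + (η - 1) * Complex.normSq n) * C := by
    have := mul_pos (mul_pos hr h1) hdet
    linarith
  have h := hermitian_pos hA hlt hne
  refine h.trans_eq ?_
  rw [hB, hC]
  simp [Complex.normSq_apply]
  ring

lemma wormDet_pos_of_near {η r c p₁ p₂ g₁ g₂ : ℝ} {n : ℂ} (hη : 1 < η) (hr : 0 < r)
    (hn : r = Complex.normSq n - 1 + c) (hc : 0 ≤ c) (hc' : c < 1 / 2) (hp : 0 ≤ p₂)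
    (hb : n.im ^ 2 < 1 / 2)
    (h : 0 < p₂ + 2 * n.re + 1 + r * (g₂ + η * g₁ ^ 2) + 2 * η * g₁ * (p₁ - n.im) -
      η ^ 2 * g₁ ^ 2 * Complex.normSq n + (η - 1) * Complex.normSq n * (g₂ + η * g₁ ^ 2) -
      (η - 1) * Complex.normSq n) :
    0 < wormDet η n r p₁ p₂ g₁ g₂ := by
  have h1 : 0 < η - 1 := by linarith
  have hN : Complex.normSq n = 1 + r - c := by linarith
  have key : wormDet η n r p₁ p₂ g₁ g₂ =
      (Complex.normSq n * (p₂ + 2 * n.re + 2 + r) + p₁ ^ 2 - 2 * p₁ * n.im) +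
      r / (η - 1) * (p₂ + 2 * n.re + 1 + r * (g₂ + η * g₁ ^ 2) + 2 * η * g₁ * (p₁ - n.im) -
      η ^ 2 * g₁ ^ 2 * Complex.normSq n + (η - 1) * Complex.normSq n * (g₂ + η * g₁ ^ 2) -
      (η - 1) * Complex.normSq n) := by
    rw [wormDet]; field_simp; ring
  rw [key]
  have h2 := mul_pos (div_pos hr h1) h
  have h3 : n.im ^ 2 + c ≤ p₂ + 2 * n.re + 2 + r := by
    rw [Complex.normSq_apply] at hn
    nlinarith [sq_nonneg (n.re + 1)]
  have h4 : (1 - c) * (n.im ^ 2 + c) ≤ Complex.normSq n * (p₂ + 2 * n.re + 2 + r) := by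
    refine mul_le_mul (by linarith) h3 (by positivity) (Complex.normSq_nonneg n)
  nlinarith [sq_nonneg (p₁ - n.im), mul_nonneg hc (by linarith : 0 ≤ 1 - c - n.im ^ 2)]

lemma wormDet_pos_of_zero {η c p₁ p₂ g₁ g₂ : ℝ} {n : ℂ}
    (hn : 0 = Complex.normSq n - 1 + c) (hc : 0 ≤ c) (hp : 0 ≤ p₂)
    (h1 : c = 1 → p₁ ≠ 0) (h0 : ¬ (c = 0 ∧ n = -1)) :
    0 < wormDet η n 0 p₁ p₂ g₁ g₂ := by
  have hw : wormDet η n 0 p₁ p₂ g₁ g₂ =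
      Complex.normSq n * (p₂ + 2 * n.re + 2) + p₁ ^ 2 - 2 * p₁ * n.im := by
    simp [wormDet]
  rw [hw]
  by_cases hn0 : n = 0
  · subst hn0
    have : c = 1 := by simp at hn; linarith
    have := h1 this
    simpa using (by positivity : 0 < p₁ ^ 2)
  have hpos := Complex.normSq_pos.2 hn0
  have hpp := mul_nonneg hpos.le hp
  suffices n.im ^ 2 < Complex.normSq n * (2 * n.re + 2) by
    nlinarith [sq_nonneg (p₁ - n.im)]
  rw [Complex.normSq_apply] at hn ⊢
  obtain ⟨a, ha⟩ : ∃ a, n.re = a - 1 := ⟨n.re + 1, by ring⟩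
  rw [ha] at hn ⊢
  set b := n.im with hb
  have hbb : b ^ 2 ≤ 2 * a - a ^ 2 := by nlinarith
  have ha0 : 0 < a := by
    rcases lt_or_ge 0 a with h | h
    · exact h
    have ha' : a = 0 := by nlinarith [sq_nonneg b, sq_nonneg a]
    subst ha'
    have hb0 : b = 0 := by nlinarith [sq_nonneg b]
    refine absurd ⟨?_, ?_⟩ h0
    · rw [hb0] at hn; linarith
    · apply Complex.ext
      · rw [ha]; simp
      · rw [← hb, hb0]; simp
  rcases lt_or_ge a (1 / 2) with h | h
  · nlinarith [mul_nonneg (by linarith : 0 ≤ 1 - 2 * a) (sub_nonneg.2 hbb)]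
  · by_cases hb0 : b = 0
    · have : a ≠ 1 := by
        rintro rfl
        apply hn0
        apply Complex.ext
        · rw [ha]; simp
        · rw [← hb, hb0]; simp
      have h3 : 0 < (a - 1) ^ 2 := by
        have := sub_ne_zero.2 this
        positivity
      rw [hb0]
      nlinarith [mul_pos ha0 h3]
    · have h3 : 0 < b ^ 2 := by positivity
      rcases eq_or_lt_of_le h with h' | h'
      · subst h'; nlinarith
      · nlinarith [mul_pos (by linarith : 0 < 2 * a - 1) h3, mul_nonneg ha0.le (sq_nonneg (a - 1))]

/-- The first two derivatives of `-s log cos(κt)`. -/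
lemma deriv_log_cos {s κ t : ℝ} (ht : Real.cos (κ * t) ≠ 0) :
    deriv (fun t => -s * Real.log (Real.cos (κ * t))) t = s * κ * Real.tan (κ * t) ∧
    deriv (deriv fun t => -s * Real.log (Real.cos (κ * t))) t =
      s * κ ^ 2 * (1 + Real.tan (κ * t) ^ 2) := by
  have hc : Continuous fun t => Real.cos (κ * t) := by fun_prop
  have hl : ∀ x : ℝ, HasDerivAt (fun t => κ * t) κ x := fun x => by
    simpa using (hasDerivAt_id x).const_mul κ
  have h1 : ∀ᶠ x in 𝓝 t, deriv (fun t => -s * Real.log (Real.cos (κ * t))) x =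
      s * κ * Real.tan (κ * x) := by
    filter_upwards [hc.continuousAt.eventually_ne ht] with x hx
    rw [((((hl x).cos).log hx).const_mul (-s)).deriv, Real.tan_eq_sin_div_cos]
    field_simp
  refine ⟨h1.self_of_nhds, ?_⟩
  rw [Filter.EventuallyEq.deriv_eq h1]
  have h2 := (((Real.hasDerivAt_tan ht).comp t (hl t)).const_mul (s * κ)).deriv
  refine h2.trans ?_
  have : 1 / Real.cos (κ * t) ^ 2 = 1 + Real.tan (κ * t) ^ 2 := by
    rw [Real.tan_eq_sin_div_cos]
    field_simp
    linarith [Real.sin_sq_add_cos_sq (κ * t)]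
  rw [this]
  ring

lemma contDiffAt_log_cos {s κ t : ℝ} (ht : Real.cos (κ * t) ≠ 0) :
    ContDiffAt ℝ (⊤ : ℕ∞) (fun t => -s * Real.log (Real.cos (κ * t))) t := by
  refine contDiffAt_const.mul (ContDiffAt.log ?_ ht)
  exact Real.contDiff_cos.contDiffAt.comp t (contDiffAt_const.mul contDiffAt_id)

lemma cos_mul_pos {κ t T : ℝ} (hκ : 0 < κ) (h : κ * T ≤ Real.pi / 2) (ht : |t| < T) :
    0 < Real.cos (κ * t) := by
  have := abs_lt.1 ht
  apply Real.cos_pos_of_mem_Ioo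
  constructor <;> nlinarith

/-- A smooth function with `ω (1 + g'²) < g''` on `[-T, T]`. -/
lemma exists_barrier {T ω : ℝ} (hT : 0 < T) (hω : 0 < ω) (h : ω * T < Real.pi / 2) :
    ∃ g : ℝ → ℝ, ContDiff ℝ (⊤ : ℕ∞) g ∧
      ∀ t, |t| ≤ T → ω * (1 + deriv g t ^ 2) < deriv (deriv g) t := by
  obtain ⟨κ, hκ1, hκ2⟩ := exists_between ((lt_div_iff₀ hT).2 h)
  have hκ : 0 < κ := hω.trans hκ1
  have hκT : T < Real.pi / 2 / κ := by
    rw [lt_div_iff₀ hκ, mul_comm]; exact (lt_div_iff₀ hT).1 hκ2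
  obtain ⟨T₁, hT1, hT1'⟩ := exists_between hκT
  obtain ⟨T₂, hT2, hT2'⟩ := exists_between hT1'
  let χ : ContDiffBump (0 : ℝ) := ⟨T₁, T₂, hT.trans hT1, hT2⟩
  set f : ℝ → ℝ := fun t => -(1 / ω) * Real.log (Real.cos (κ * t)) with hf
  have hcos : ∀ t : ℝ, |t| < Real.pi / 2 / κ → Real.cos (κ * t) ≠ 0 := fun t ht =>
    (cos_mul_pos hκ (by field_simp; rfl) ht).ne'
  refine ⟨fun t => χ t * f t, ?_, ?_⟩
  · rw [contDiff_iff_contDiffAt]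
    intro t
    by_cases ht : |t| < Real.pi / 2 / κ
    · exact χ.contDiff.contDiffAt.mul (contDiffAt_log_cos (hcos t ht))
    · have hz : (fun t => χ t * f t) =ᶠ[𝓝 t] fun _ => 0 := by
        have hts : t ∉ tsupport χ := by
          rw [χ.tsupport_eq, Metric.mem_closedBall, dist_zero_right, Real.norm_eq_abs]
          show ¬ |t| ≤ T₂
          linarith
        filter_upwards [(isClosed_tsupport χ).isOpen_compl.mem_nhds hts] with x hx
        rw [image_eq_zero_of_notMem_tsupport hx, zero_mul]
      exact contDiffAt_const.congr_of_eventuallyEq hz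
  · intro t ht
    have he : (fun t => χ t * f t) =ᶠ[𝓝 t] f := by
      have : t ∈ Metric.ball (0 : ℝ) T₁ := by
        rw [Metric.mem_ball, dist_zero_right, Real.norm_eq_abs]; linarith
      filter_upwards [Metric.isOpen_ball.mem_nhds this] with x hx
      rw [χ.one_of_mem_closedBall (Metric.ball_subset_closedBall hx), one_mul]
    have hd := deriv_log_cos (s := 1 / ω) (hcos t (by linarith))
    rw [he.deriv_eq, he.deriv.deriv_eq, hd.1, hd.2]
    have hlt : ω < κ ^ 2 / ω := by rw [lt_div_iff₀ hω]; nlinarith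
    have e1 : ω * (1 + (1 / ω * κ * Real.tan (κ * t)) ^ 2) =
        ω + κ ^ 2 / ω * Real.tan (κ * t) ^ 2 := by field_simp
    rw [e1]
    have e2 : 1 / ω * κ ^ 2 * (1 + Real.tan (κ * t) ^ 2) =
      κ ^ 2 / ω + κ ^ 2 / ω * Real.tan (κ * t) ^ 2 := by field_simp
    rw [e2]
    linarith

lemma two_le_smooth : (2 : WithTop ℕ∞) ≤ ((⊤ : ℕ∞) : WithTop ℕ∞) := by
  have : ((2 : ℕ∞) : WithTop ℕ∞) ≤ ((⊤ : ℕ∞) : WithTop ℕ∞) := WithTop.coe_le_coe.2 le_top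
  exact this

lemma contDiffAt_wormAngle {q : Fin 2 → ℂ} (hq : q 1 ≠ 0) :
    ContDiffAt ℝ (⊤ : ℕ∞) wormAngle q := by
  have h1 : ContDiffAt ℝ (⊤ : ℕ∞) (fun q : Fin 2 → ℂ => Complex.normSq (q 1)) q := by
    have : (fun q : Fin 2 → ℂ => Complex.normSq (q 1)) = fun q => ‖q 1‖ ^ 2 := by
      ext q; exact Complex.normSq_eq_norm_sq _
    rw [this]
    exact ((contDiff_apply ℝ ℂ (1 : Fin 2)).norm_sq ℝ).contDiffAt
  exact h1.log (by simpa using hq)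

lemma contDiffAt_wormRot {q : Fin 2 → ℂ} (hq : q 1 ≠ 0) :
    ContDiffAt ℝ (⊤ : ℕ∞) wormRot q := by
  have h0 : ContDiffAt ℝ (⊤ : ℕ∞) (fun q : Fin 2 → ℂ => q 0) q :=
    (contDiff_apply ℝ ℂ (0 : Fin 2)).contDiffAt
  have h1 : ContDiffAt ℝ (⊤ : ℕ∞) (fun q : Fin 2 → ℂ => (wormAngle q : ℂ)) q :=
    Complex.ofRealCLM.contDiff.contDiffAt.comp q (contDiffAt_wormAngle hq)
  exact (h0.mul (contDiffAt_const.mul h1).cexp).sub contDiffAt_const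

lemma contDiffAt_wormRho {φ : ℝ → ℝ} (hφ : ContDiff ℝ (⊤ : ℕ∞) φ) {q : Fin 2 → ℂ}
    (hq : q 1 ≠ 0) : ContDiffAt ℝ (⊤ : ℕ∞) (wormRho φ) q := by
  have : wormRho φ = fun q => ‖wormRot q‖ ^ 2 - 1 + φ (wormAngle q) := by
    ext q; rw [wormRho_eq_rot, Complex.normSq_eq_norm_sq]
  rw [this]
  exact (((contDiffAt_wormRot hq).norm_sq ℝ).sub contDiffAt_const).add
    (hφ.contDiffAt.comp q (contDiffAt_wormAngle hq))

lemma isOpen_ne_zero : IsOpen {q : Fin 2 → ℂ | q 1 ≠ 0} :=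
  isOpen_ne.preimage (continuous_apply 1)

lemma isOpen_wormDomain {φ : ℝ → ℝ} (hφ : ContDiff ℝ (⊤ : ℕ∞) φ) : IsOpen (wormDomain φ) := by
  rw [isOpen_iff_mem_nhds]
  rintro q ⟨hq, hr⟩
  filter_upwards [isOpen_ne_zero.mem_nhds hq,
    (contDiffAt_wormRho hφ hq).continuousAt.eventually_lt continuousAt_const hr] with x h1 h2
    using ⟨h1, h2⟩

lemma closure_wormDomain_subset {φ : ℝ → ℝ} {β : ℝ} (hφ : IsWormFunction φ β) :
    closure (wormDomain φ) ⊆ {q | q 1 ≠ 0} := by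
  obtain ⟨a, -, ha⟩ := hφ.large
  have hcl : IsClosed {q : Fin 2 → ℂ | Real.exp (-a) ≤ Complex.normSq (q 1)} :=
    isClosed_le continuous_const (Complex.continuous_normSq.comp (continuous_apply 1))
  have hsub : wormDomain φ ⊆ {q : Fin 2 → ℂ | Real.exp (-a) ≤ Complex.normSq (q 1)} := by
    rintro q ⟨hq, hr⟩
    have ht : |wormAngle q| ≤ a := by
      by_contra! h
      have := ha _ h
      rw [wormRho_eq_rot] at hr
      linarith [Complex.normSq_nonneg (wormRot q)]
    show Real.exp (-a) ≤ Complex.normSq (q 1)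
    rw [← Real.le_log_iff_exp_le (Complex.normSq_pos.2 hq)]
    exact (abs_le.1 ht).1
  intro q hq
  have : Real.exp (-a) ≤ Complex.normSq (q 1) := closure_minimal hsub hcl hq
  exact Complex.normSq_pos.1 ((Real.exp_pos _).trans_le this)

lemma wormRho_eq_zero_of_mem_frontier {φ : ℝ → ℝ} {β : ℝ} (hφ : IsWormFunction φ β)
    {q : Fin 2 → ℂ} (hq : q ∈ frontier (wormDomain φ)) : q 1 ≠ 0 ∧ wormRho φ q = 0 := by
  have hq1 := closure_wormDomain_subset hφ (frontier_subset_closure hq)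
  refine ⟨hq1, le_antisymm ?_ ?_⟩
  · by_contra! h
    have hev := continuousAt_const.eventually_lt (contDiffAt_wormRho hφ.smooth hq1).continuousAt h
    obtain ⟨x, hx1, hx2⟩ := mem_closure_iff_nhds.1 (frontier_subset_closure hq) _ hev
    exact absurd hx1 (not_lt.2 hx2.2.le)
  · by_contra! h
    rw [(isOpen_wormDomain hφ.smooth).frontier_eq] at hq
    exact hq.2 ⟨hq1, h⟩

/-- The derivative of `r e^g` does not vanish on `{r = 0}`. -/
lemma fderiv_wormRho_mul_exp_ne_zero {φ g : ℝ → ℝ} {β : ℝ} (hφ : IsWormFunction φ β)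
    (hg : ContDiff ℝ (⊤ : ℕ∞) g) {q : Fin 2 → ℂ} (hq : q 1 ≠ 0) (hr : wormRho φ q = 0) :
    fderiv ℝ (fun q => wormRho φ q * Real.exp (g (wormAngle q))) q ≠ 0 := by
  intro h0
  have hφ2 : ContDiff ℝ 2 φ := hφ.smooth.of_le two_le_smooth
  have hsm : ContDiffAt ℝ 2 (fun q => wormRho φ q * Real.exp (g (wormAngle q))) q :=
    ((contDiffAt_wormRho hφ.smooth hq).mul
      (hg.contDiffAt.comp q (contDiffAt_wormAngle hq)).exp).of_le two_le_smooth
  have key : ∀ E y : ℂ, (E * (starRingEnd ℂ) (wormRot q) +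
      y * (deriv φ (wormAngle q) + Complex.I * wormRot q)).re = 0 := by
    intro E y
    have h1 := hasLevi_wormRho hφ2 hq (E := E)
      (X := ![(E + Complex.I * y) * Complex.exp (Complex.I * wormAngle q), y * q 1])
      (y := y) (by simp [hq]) rfl (by
        simp [mul_assoc, ← Complex.exp_add])
    have h2 := (h1.mul_exp hq (hg.contDiffAt.of_le two_le_smooth)).fderiv_eq hsm
    rw [h0, hr] at h2
    simp only [zero_apply, Complex.ofReal_zero, zero_mul, add_zero,
      Complex.re_ofReal_mul] at h2
    have h3 := (Real.exp_pos (g (wormAngle q))).ne'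
    rcases mul_eq_zero.1 (mul_eq_zero.1 h2.symm |>.resolve_left two_ne_zero) with h | h
    · exact absurd h h3
    · exact h
  have hn : wormRot q = 0 := by
    have := key (wormRot q) 0
    rw [Complex.mul_conj] at this
    simpa using this
  have hp := key 0 1
  rw [hn] at hp
  simp at hp
  rw [wormRho_eq_rot, hn] at hr
  exact hφ.deriv_ne (wormAngle q) (by simp at hr; linarith) hp

lemma wormRho_pos_of_notMem_closure {φ : ℝ → ℝ} {β : ℝ} (hφ : IsWormFunction φ β)
    {q : Fin 2 → ℂ} (hq : q 1 ≠ 0) (hc : q ∉ closure (wormDomain φ)) : 0 < wormRho φ q := by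
  have h0 : ∀ x : Fin 2 → ℂ, x 1 ≠ 0 → x ∉ closure (wormDomain φ) → 0 ≤ wormRho φ x := by
    intro x hx hxc
    by_contra! h
    exact hxc (subset_closure ⟨hx, h⟩)
  refine lt_of_le_of_ne (h0 q hq hc) fun hr => ?_
  refine fderiv_wormRho_mul_exp_ne_zero hφ (g := fun _ => 0) contDiff_const hq hr.symm ?_
  apply IsLocalMin.fderiv_eq_zero
  filter_upwards [isOpen_ne_zero.mem_nhds hq,
    isClosed_closure.isOpen_compl.mem_nhds hc] with x h1 h2
  simpa [← hr] using h0 x h1 h2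

lemma isDefFn_wormRho_mul_exp {φ g : ℝ → ℝ} {β : ℝ} (hφ : IsWormFunction φ β)
    (hg : ContDiff ℝ (⊤ : ℕ∞) g) :
    IsDefFn (wormDomain φ) {q | q 1 ≠ 0}
      (fun q => wormRho φ q * Real.exp (g (wormAngle q))) where
  isOpen := isOpen_ne_zero
  subset := closure_wormDomain_subset hφ
  smooth q hq := ((contDiffAt_wormRho hφ.smooth hq).mul
      (hg.contDiffAt.comp q (contDiffAt_wormAngle hq)).exp).contDiffWithinAt
  eq := by
    ext q
    simp only [wormDomain, Set.mem_ofPred_eq, mul_neg_iff, Real.exp_pos, and_true,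
      (Real.exp_pos _).not_gt, and_false, false_or]
  grad_ne q hq := by
    obtain ⟨h1, h2⟩ := wormRho_eq_zero_of_mem_frontier hφ hq
    exact fderiv_wormRho_mul_exp_ne_zero hφ hg h1 h2

lemma IsWormFunction.deriv_deriv_nonneg {φ : ℝ → ℝ} {β : ℝ} (hφ : IsWormFunction φ β) (t : ℝ) :
    0 ≤ deriv (deriv φ) t := by
  have hd : Differentiable ℝ φ := hφ.smooth.differentiable (by simp)
  have := hφ.convex.monotoneOn_deriv fun x _ => hd x
  exact (monotoneOn_univ.1 this).deriv_nonneg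

lemma IsWormFunction.eq_zero_iff {φ : ℝ → ℝ} {β : ℝ} (hφ : IsWormFunction φ β) {t : ℝ} :
    φ t = 0 ↔ |t| ≤ β - Real.pi / 2 := by
  rw [abs_le, ← Set.mem_Icc, ← hφ.zeroSet]
  rfl

lemma eventually_wormDet_pos {φ g : ℝ → ℝ} {β η : ℝ} (hφ : IsWormFunction φ β)
    (hg : ContDiff ℝ (⊤ : ℕ∞) g) (hη : 1 < η)
    (hgT : ∀ t, |t| ≤ β - Real.pi / 2 →
      η / (η - 1) * (1 + deriv g t ^ 2) < deriv (deriv g) t)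
    {p : Fin 2 → ℂ} (hp : p ∈ frontier (wormDomain φ)) :
    ∀ᶠ q in 𝓝 p, 0 < wormRho φ q → 0 < wormDet η (wormRot q) (wormRho φ q)
      (deriv φ (wormAngle q)) (deriv (deriv φ) (wormAngle q)) (deriv g (wormAngle q))
      (deriv (deriv g) (wormAngle q)) := by
  obtain ⟨hp1, hr⟩ := wormRho_eq_zero_of_mem_frontier hφ hp
  have ct : ContinuousAt wormAngle p := (contDiffAt_wormAngle hp1).continuousAt
  have cn : ContinuousAt wormRot p := (contDiffAt_wormRot hp1).continuousAt
  have cr : ContinuousAt (wormRho φ) p := (contDiffAt_wormRho hφ.smooth hp1).continuousAt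
  have cni : ContinuousAt (fun q => (wormRot q).im) p := Complex.continuous_im.continuousAt.comp cn
  have cnr : ContinuousAt (fun q => (wormRot q).re) p := Complex.continuous_re.continuousAt.comp cn
  have cnn : ContinuousAt (fun q => Complex.normSq (wormRot q)) p :=
    Complex.continuous_normSq.continuousAt.comp cn
  have cφ : ContinuousAt (fun q => φ (wormAngle q)) p :=
    hφ.smooth.continuous.continuousAt.comp ct
  have hφ' := (contDiff_infty_iff_deriv.1 hφ.smooth).2
  have hφ'' := (contDiff_infty_iff_deriv.1 hφ').2
  have hg' := (contDiff_infty_iff_deriv.1 hg).2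
  have hg'' := (contDiff_infty_iff_deriv.1 hg').2
  have cφ' : ContinuousAt (fun q => deriv φ (wormAngle q)) p :=
    hφ'.continuous.continuousAt.comp ct
  have cφ'' : ContinuousAt (fun q => deriv (deriv φ) (wormAngle q)) p :=
    hφ''.continuous.continuousAt.comp ct
  have cg' : ContinuousAt (fun q => deriv g (wormAngle q)) p := hg'.continuous.continuousAt.comp ct
  have cg'' : ContinuousAt (fun q => deriv (deriv g) (wormAngle q)) p :=
    hg''.continuous.continuousAt.comp ct
  have hr' := wormRho_eq_rot φ p
  by_cases hA : φ (wormAngle p) = 0 ∧ wormRot p = -1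
  · have hT := hgT _ (hφ.eq_zero_iff.1 hA.1)
    have hd0 : deriv φ (wormAngle p) = 0 := by
      apply IsLocalMin.deriv_eq_zero
      exact Filter.Eventually.of_forall fun x => hA.1.le.trans (hφ.nonneg x)
    let F : (Fin 2 → ℂ) → ℝ := fun q => deriv (deriv φ) (wormAngle q) + 2 * (wormRot q).re + 1 +
        wormRho φ q * (deriv (deriv g) (wormAngle q) + η * deriv g (wormAngle q) ^ 2) +
        2 * η * deriv g (wormAngle q) * (deriv φ (wormAngle q) - (wormRot q).im) -
        η ^ 2 * deriv g (wormAngle q) ^ 2 * Complex.normSq (wormRot q) +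
        (η - 1) * Complex.normSq (wormRot q) *
          (deriv (deriv g) (wormAngle q) + η * deriv g (wormAngle q) ^ 2) -
        (η - 1) * Complex.normSq (wormRot q)
    have cF : ContinuousAt F p := by
      simp only [F]
      fun_prop
    have hb : 0 < F p := by
      simp only [F]
      have h1 : 0 < η - 1 := by linarith
      rw [hr, hd0, hA.2]
      rw [div_mul_eq_mul_div, div_lt_iff₀ h1] at hT
      have := hφ.deriv_deriv_nonneg (wormAngle p)
      simp
      nlinarith
    have e1 := (continuousAt_const (y := (0 : ℝ))).eventually_lt cF hb
    have e2 := cφ.eventually_lt (continuousAt_const (y := (1 / 2 : ℝ))) (by rw [hA.1]; norm_num)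
    have cni2 : ContinuousAt (fun q => (wormRot q).im ^ 2) p := cni.pow 2
    have e3 := cni2.eventually_lt (continuousAt_const (y := (1 / 2 : ℝ)))
      (by rw [hA.2]; norm_num)
    filter_upwards [e1, e2, e3] with q h1 h2 h3 hq
    exact wormDet_pos_of_near hη hq (wormRho_eq_rot φ q) (hφ.nonneg _) h2
      (hφ.deriv_deriv_nonneg _) h3 h1
  · have hb : 0 < wormDet η (wormRot p) (wormRho φ p)
      (deriv φ (wormAngle p)) (deriv (deriv φ) (wormAngle p)) (deriv g (wormAngle p))
      (deriv (deriv g) (wormAngle p)) := by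
      rw [hr]
      rw [hr] at hr'
      exact wormDet_pos_of_zero hr' (hφ.nonneg _) (hφ.deriv_deriv_nonneg _) (hφ.deriv_ne _) hA
    have e1 := (continuousAt_const (y := (0 : ℝ))).eventually_lt
      (g := fun q => wormDet η (wormRot q) (wormRho φ q) (deriv φ (wormAngle q))
        (deriv (deriv φ) (wormAngle q)) (deriv g (wormAngle q)) (deriv (deriv g) (wormAngle q)))
      (by unfold wormDet; fun_prop) hb
    filter_upwards [e1] with q h _ using h

/-- A barrier on `[-(β - π/2), β - π/2]` yields a Steinness exponent. -/
lemma mem_steinExpSet_of_barrier {φ g : ℝ → ℝ} {β η : ℝ} (hφ : IsWormFunction φ β)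
    (hg : ContDiff ℝ (⊤ : ℕ∞) g) (hη : 1 < η)
    (hgT : ∀ t, |t| ≤ β - Real.pi / 2 →
      η / (η - 1) * (1 + deriv g t ^ 2) < deriv (deriv g) t) :
    η ∈ steinExpSet (wormDomain φ) (fun q => wormRho φ q * Real.exp (g (wormAngle q))) := by
  refine ⟨hη, interior {q | q 1 ≠ 0 ∧ (0 < wormRho φ q → 0 < wormDet η (wormRot q) (wormRho φ q)
      (deriv φ (wormAngle q)) (deriv (deriv φ) (wormAngle q)) (deriv g (wormAngle q))
      (deriv (deriv g) (wormAngle q)))}, isOpen_interior, fun p hp => ?_, ?_⟩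
  · rw [mem_interior_iff_mem_nhds]
    filter_upwards [isOpen_ne_zero.mem_nhds (wormRho_eq_zero_of_mem_frontier hφ hp).1,
      eventually_wormDet_pos hφ hg hη hgT hp] with q h1 h2 using ⟨h1, h2⟩
  · rintro q ⟨hqc, hqW⟩ X hX
    obtain ⟨hq, hdet⟩ := interior_subset hqW
    have hr := wormRho_pos_of_notMem_closure hφ hq hqc
    have hsm : ContDiffAt ℝ 2 (fun q => (wormRho φ q * Real.exp (g (wormAngle q))) ^ η) q :=
      (((contDiffAt_wormRho hφ.smooth hq).mul
        (hg.contDiffAt.comp q (contDiffAt_wormAngle hq)).exp).rpow_const_of_ne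
          (mul_pos hr (Real.exp_pos _)).ne').of_le two_le_smooth
    set E : ℂ := X 0 * Complex.exp (-Complex.I * wormAngle q) - Complex.I * (X 1 / q 1) with hE
    have h1 := hasLevi_wormRho (hφ.smooth.of_le two_le_smooth) hq (X := X) rfl rfl
      (sub_add_cancel (X 0 * Complex.exp (-Complex.I * wormAngle q))
        (Complex.I * (X 1 / q 1))).symm
    obtain ⟨d, h2⟩ := h1.mul_exp_rpow hq (hg.contDiffAt.of_le two_le_smooth) hr η
    rw [h2.levi_re hsm]
    have hne : E ≠ 0 ∨ X 1 / q 1 ≠ 0 := by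
      by_contra! h
      apply hX
      have h11 : X 1 = 0 := by simpa [hq] using h.2
      have h10 : X 0 = 0 := by
        have := h.1
        rw [hE, h.2] at this
        simpa using this
      ext j
      fin_cases j
      · exact h10
      · exact h11
    refine mul_pos (mul_pos (mul_pos (by linarith)
      (Real.rpow_pos_of_pos (mul_pos hr (Real.exp_pos _)) _)) (by positivity)) ?_
    exact wormForm_pos hη hr (hdet hr) hne

lemma steinIndex_wormDomain_le {φ : ℝ → ℝ} {β : ℝ} (hφ : IsWormFunction φ β)
    (hβ : Real.pi / 2 < β) (hβ' : β < Real.pi) :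
    steinIndex (wormDomain φ) ≤ ENNReal.ofReal (Real.pi / (2 * (Real.pi - β))) := by
  have hpos : 0 < 2 * (Real.pi - β) := by linarith
  suffices h : ∀ η : ℝ, Real.pi / (2 * (Real.pi - β)) < η →
      steinIndex (wormDomain φ) ≤ ENNReal.ofReal η by
    have hc : Filter.Tendsto ENNReal.ofReal (𝓝[>] (Real.pi / (2 * (Real.pi - β))))
        (𝓝 (ENNReal.ofReal (Real.pi / (2 * (Real.pi - β))))) :=
      (ENNReal.continuous_ofReal.tendsto _).mono_left nhdsWithin_le_nhds
    exact ge_of_tendsto hc (by filter_upwards [self_mem_nhdsWithin] with η hη using h η hη)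
  intro η hη
  have h1 : 1 < η := by
    refine lt_trans ?_ hη
    rw [lt_div_iff₀ hpos]; linarith
  have h2 : 0 < η - 1 := by linarith
  rw [div_lt_iff₀ hpos] at hη
  obtain ⟨g, hg, hgT⟩ := exists_barrier (T := β - Real.pi / 2) (ω := η / (η - 1))
    (by linarith) (by positivity) (by
      rw [div_mul_eq_mul_div, div_lt_iff₀ h2]; linarith)
  refine (iInf₂_le_of_le _ _ (iInf_le _ (isDefFn_wormRho_mul_exp hφ hg))).trans ?_
  exact sInf_le ⟨η, mem_steinExpSet_of_barrier hφ hg h1 hgT, rfl⟩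

/-- A function on a disc whose Laplacian is positive has no maximum inside the disc. -/
lemma no_interior_max {H : ℂ → ℝ} {δ : ℝ} (hδ : 0 < δ)
    (hc : ContinuousOn H (Metric.closedBall 0 δ)) (hs : ∀ τ ∈ Metric.sphere (0 : ℂ) δ, H τ < H 0)
    (hj : ∀ τ ∈ Metric.ball (0 : ℂ) δ, ∃ a b a' b', HasJet (fun s : ℝ => H (τ + s * 1)) a b ∧
      HasJet (fun s : ℝ => H (τ + s * Complex.I)) a' b' ∧ 0 < b + b') : False := by
  obtain ⟨τ, hτ, hmax⟩ := (isCompact_closedBall (0 : ℂ) δ).exists_isMaxOn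
    ⟨0, Metric.mem_closedBall_self hδ.le⟩ hc
  have hball : τ ∈ Metric.ball (0 : ℂ) δ := by
    rcases (Metric.mem_closedBall.1 hτ).lt_or_eq with h | h
    · exact h
    · exact absurd (hmax (Metric.mem_closedBall_self hδ.le)) (not_le.2 (hs τ h))
  have hloc : IsLocalMax H τ :=
    hmax.isLocalMax (Filter.mem_of_superset (Metric.isOpen_ball.mem_nhds hball)
      Metric.ball_subset_closedBall)
  have hline : ∀ v : ℂ, IsLocalMax (fun s : ℝ => H (τ + s * v)) 0 := by
    intro v
    have hcont : Filter.Tendsto (fun s : ℝ => τ + s * v) (𝓝 0) (𝓝 τ) := by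
      have : Continuous fun s : ℝ => τ + s * v := by fun_prop
      simpa using this.tendsto 0
    have := hcont.eventually hloc
    simpa [IsLocalMax, IsMaxFilter] using this
  obtain ⟨a, b, a', b', h1, h2, h3⟩ := hj τ hball
  linarith [h1.nonpos_of_isLocalMax (hline 1), h2.nonpos_of_isLocalMax (hline Complex.I)]

lemma hasJet_normSq_line (τ v : ℂ) :
    ∃ a, HasJet (fun s : ℝ => Complex.normSq (τ + s * v)) a (2 * Complex.normSq v) := by
  have h1 := HasJet.affine τ.re v.re
  have h2 := HasJet.affine τ.im v.im
  have h := (h1.mul h1).add (h2.mul h2)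
  have e1 : (fun s : ℝ => Complex.normSq (τ + s * v)) = fun s => (τ.re + s * v.re) *
      (τ.re + s * v.re) + (τ.im + s * v.im) * (τ.im + s * v.im) := by
    ext s; simp [Complex.normSq_apply]
  rw [e1]
  refine ⟨_, (congrArg _ ?_).mp h⟩
  simp [Complex.normSq_apply]; ring

namespace IsDefFn

lemma contDiffAt {n : ℕ} {Ω V : Set (Fin n → ℂ)} {ρ : (Fin n → ℂ) → ℝ} (h : IsDefFn Ω V ρ)
    {q : Fin n → ℂ} (hq : q ∈ V) : ContDiffAt ℝ (⊤ : ℕ∞) ρ q :=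
  h.smooth.contDiffAt (h.isOpen.mem_nhds hq)

lemma nonpos_of_mem_closure {n : ℕ} {Ω V : Set (Fin n → ℂ)} {ρ : (Fin n → ℂ) → ℝ}
    (h : IsDefFn Ω V ρ) {q : Fin n → ℂ} (hq : q ∈ closure Ω) : ρ q ≤ 0 := by
  by_contra! hpos
  have hev := continuousAt_const.eventually_lt (h.contDiffAt (h.subset hq)).continuousAt hpos
  obtain ⟨x, hx1, hx2⟩ := mem_closure_iff_nhds.1 hq _ hev
  rw [h.eq] at hx2
  exact absurd hx1 (not_lt.2 hx2.2.le)

lemma eq_zero_of_mem_frontier {n : ℕ} {Ω V : Set (Fin n → ℂ)} {ρ : (Fin n → ℂ) → ℝ}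
    (h : IsDefFn Ω V ρ) (hΩ : IsOpen Ω) {q : Fin n → ℂ} (hq : q ∈ frontier Ω) : ρ q = 0 := by
  refine le_antisymm (h.nonpos_of_mem_closure (frontier_subset_closure hq)) ?_
  by_contra! hneg
  rw [hΩ.frontier_eq] at hq
  refine hq.2 ?_
  rw [h.eq]
  exact ⟨h.subset hq.1, hneg⟩

lemma continuousAt_fderiv {n : ℕ} {Ω V : Set (Fin n → ℂ)} {ρ : (Fin n → ℂ) → ℝ}
    (h : IsDefFn Ω V ρ) {q : Fin n → ℂ} (hq : q ∈ V) : ContinuousAt (fderiv ℝ ρ) q :=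
  (((h.contDiffAt hq).of_le two_le_smooth).fderiv_right (m := 1) (by norm_num)).continuousAt

end IsDefFn

/-- If the rescalings of `ρ^η` towards a complex curve in the boundary are dominated by a model
function with negative Levi form in some direction, with equality at one point, then `ρ^η` is not
strictly plurisubharmonic outside the domain. -/
theorem not_strictPSHOn_of_model {Ω V W : Set (Fin 2 → ℂ)} {ρ U : (Fin 2 → ℂ) → ℝ} {η : ℝ}
    (hρ : IsDefFn Ω V ρ) (hW : IsOpen W) (hη : 0 < η)
    (hpsh : StrictPSHOn (fun z => ρ z ^ η) ((closure Ω)ᶜ ∩ W))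
    {p X : Fin 2 → ℂ} (hX : X 1 ≠ 0) (hU : ContDiffAt ℝ (⊤ : ℕ∞) U p)
    (hneg : fderiv ℝ (fderiv ℝ U) p X X +
      fderiv ℝ (fderiv ℝ U) p (Complex.I • X) (Complex.I • X) < 0)
    (hV : ![0, p 1] ∈ V) (hpW : ![0, p 1] ∈ W)
    (hzero : ∀ᶠ τ in 𝓝 (0 : ℂ), ρ ![0, (p + τ • X) 1] = 0)
    (hle : ∀ᶠ τ in 𝓝 (0 : ℂ),
      fderiv ℝ ρ ![0, (p + τ • X) 1] ![(p + τ • X) 0, 0] ^ η ≤ U (p + τ • X))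
    (heq : fderiv ℝ ρ ![0, p 1] ![p 0, 0] ^ η = U p)
    (hpos : 0 < fderiv ℝ ρ ![0, p 1] ![p 0, 0]) : False := by
  set pt : ℝ → ℂ → (Fin 2 → ℂ) := fun s τ => ![s * (p + τ • X) 0, (p + τ • X) 1] with hpt
  set Ψ : ℝ → ℂ → ℝ := fun s τ => fderiv ℝ ρ (pt s τ) ![(p + τ • X) 0, 0] with hΨ
  have cpt : Continuous fun y : ℝ × ℂ => pt y.1 y.2 := by
    simp only [hpt]
    refine continuous_pi fun j => ?_
    fin_cases j
    · simp; fun_prop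
    · simp; fun_prop
  have cl : Continuous fun τ : ℂ => p + τ • X := by fun_prop
  have pt0 : ∀ τ, pt 0 τ = ![0, (p + τ • X) 1] := fun τ => by simp [hpt]
  have pt00 : pt 0 0 = ![0, p 1] := by simp [hpt]
  have cΨ : ∀ s τ, pt s τ ∈ V → ContinuousAt (fun y : ℝ × ℂ => Ψ y.1 y.2) (s, τ) := by
    intro s τ h
    have h1 : ContinuousAt (fun y : ℝ × ℂ => fderiv ℝ ρ (pt y.1 y.2)) (s, τ) :=
      ContinuousAt.comp (f := fun y : ℝ × ℂ => pt y.1 y.2) (x := (s, τ))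
        (hρ.continuousAt_fderiv h) cpt.continuousAt
    have h2 : Continuous fun y : ℝ × ℂ => (![(p + y.2 • X) 0, 0] : Fin 2 → ℂ) := by
      refine continuous_pi fun j => ?_
      fin_cases j
      · simp; fun_prop
      · simp; fun_prop
    exact h1.clm_apply h2.continuousAt
  set Λ : (Fin 2 → ℂ) → ℝ := fun q => fderiv ℝ (fderiv ℝ U) q X X +
      fderiv ℝ (fderiv ℝ U) q (Complex.I • X) (Complex.I • X) with hΛ
  have cΛ : ContinuousAt Λ p := by
    have h1 : ContDiffAt ℝ (⊤ : ℕ∞) (fderiv ℝ U) p := hU.fderiv_right (by simp)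
    have h2 : ContDiffAt ℝ (⊤ : ℕ∞) (fderiv ℝ (fderiv ℝ U)) p := h1.fderiv_right (by simp)
    have h3 := h2.continuousAt
    exact ((h3.clm_apply continuousAt_const).clm_apply continuousAt_const).add
      ((h3.clm_apply continuousAt_const).clm_apply continuousAt_const)
  obtain ⟨c, hc, hcΛ⟩ : ∃ c : ℝ, 0 < c ∧ Λ p + 4 * c < 0 := by
    refine ⟨-Λ p / 8, ?_, ?_⟩ <;> simp only [hΛ] <;> linarith
  have hA : ∀ᶠ y : ℝ × ℂ in 𝓝 (0, 0), (pt y.1 y.2 ∈ V ∧ pt y.1 y.2 ∈ W) ∧ 0 < Ψ y.1 y.2 := by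
    have h1 := cpt.continuousAt (x := ((0 : ℝ), (0 : ℂ)))
    refine ((h1.eventually (hρ.isOpen.mem_nhds (by simpa [pt00] using hV))).and
      (h1.eventually (hW.mem_nhds (by simpa [pt00] using hpW)))).and ?_
    refine continuousAt_const.eventually_lt (cΨ 0 0 (by rw [pt00]; exact hV)) ?_
    simpa [hΨ, pt00] using hpos
  have hB : ∀ᶠ τ in 𝓝 (0 : ℂ), (ρ (pt 0 τ) = 0 ∧ Ψ 0 τ ^ η ≤ U (p + τ • X)) ∧
      ContDiffAt ℝ 2 U (p + τ • X) ∧ Λ (p + τ • X) + 4 * c < 0 := by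
    have hl : Filter.Tendsto (fun τ : ℂ => p + τ • X) (𝓝 0) (𝓝 p) := by
      simpa using cl.tendsto 0
    refine Filter.Eventually.and ?_ ((hl.eventually ((hU.of_le two_le_smooth).eventually
      (by simp))).and (hl.eventually ((cΛ.add continuousAt_const).eventually_lt
        continuousAt_const hcΛ)))
    filter_upwards [hzero, hle] with τ h1 h2
    simp only [hΨ, pt0]
    exact ⟨h1, h2⟩
  obtain ⟨δ₁, hδ₁, hA⟩ := Metric.eventually_nhds_iff.1 hA
  obtain ⟨δ₂, hδ₂, hB⟩ := Metric.eventually_nhds_iff.1 hB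
  obtain ⟨δ, hδ, hδm⟩ := exists_between (lt_min hδ₁ hδ₂)
  rw [lt_min_iff] at hδm
  have hA' : ∀ s : ℝ, ∀ τ : ℂ, |s| < δ₁ → ‖τ‖ ≤ δ →
      (pt s τ ∈ V ∧ pt s τ ∈ W) ∧ 0 < Ψ s τ := by
    intro s τ hs hτ
    refine hA (y := (s, τ)) ?_
    rw [Prod.dist_eq, max_lt_iff]
    simp only [dist_zero_right, Real.norm_eq_abs]
    exact ⟨hs, hτ.trans_lt hδm.1⟩
  have hB' : ∀ τ : ℂ, ‖τ‖ ≤ δ → (ρ (pt 0 τ) = 0 ∧ Ψ 0 τ ^ η ≤ U (p + τ • X)) ∧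
      ContDiffAt ℝ 2 U (p + τ • X) ∧ Λ (p + τ • X) + 4 * c < 0 := fun τ hτ =>
    hB (y := τ) (by rw [dist_zero_right]; exact hτ.trans_lt hδm.2)
  have cG : ∀ τ : ℂ, ‖τ‖ ≤ δ →
      ContinuousAt (fun y : ℝ × ℂ => Ψ y.1 y.2 ^ η - U (p + y.2 • X)) (0, τ) := by
    intro τ hτ
    refine ((cΨ 0 τ (hA' 0 τ (by simpa using hδ₁) hτ).1.1).rpow_const (Or.inr hη.le)).sub ?_
    exact ContinuousAt.comp (f := fun y : ℝ × ℂ => p + y.2 • X) (x := ((0 : ℝ), τ))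
      (hB' τ hτ).2.1.continuousAt (by fun_prop)
  have hcδ : 0 < c * δ ^ 2 / 2 := by positivity
  have hE1 : ∀ᶠ s in 𝓝 (0 : ℝ), ∀ τ ∈ Metric.sphere (0 : ℂ) δ,
      Ψ s τ ^ η - U (p + τ • X) < c * δ ^ 2 / 2 := by
    refine (isCompact_sphere (0 : ℂ) δ).eventually_forall_of_forall_eventually fun τ hτ => ?_
    rw [mem_sphere_zero_iff_norm] at hτ
    refine (cG τ hτ.le).eventually_lt continuousAt_const ?_
    exact (sub_nonpos.2 (hB' τ hτ.le).1.2).trans_lt hcδ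
  have hE2 : ∀ᶠ s in 𝓝 (0 : ℝ), -(c * δ ^ 2 / 2) < Ψ s 0 ^ η - U p := by
    have h1 : ContinuousAt (fun s : ℝ => Ψ s 0 ^ η - U (p + (0 : ℂ) • X)) 0 :=
      ContinuousAt.comp (f := fun s : ℝ => (s, (0 : ℂ))) (x := (0 : ℝ))
        (cG 0 (by simpa using hδ.le)) (by fun_prop)
    have h2 := continuousAt_const.eventually_lt (f := fun _ => -(c * δ ^ 2 / 2)) h1 (by
      simp only [hΨ, pt00, zero_smul, add_zero, heq, sub_self]
      linarith)
    simpa using h2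
  obtain ⟨ε₀, hε₀, hE⟩ := Metric.eventually_nhds_iff.1 (hE1.and hE2)
  obtain ⟨ε, hε, hεm⟩ := exists_between (lt_min hε₀ hδ₁)
  rw [lt_min_iff] at hεm
  have hmv : ∀ τ : ℂ, ‖τ‖ ≤ δ → ∃ s ∈ Set.Ioo 0 ε, ρ (pt ε τ) = ε * Ψ s τ := by
    intro τ hτ
    have hd : ∀ s ∈ Set.Icc 0 ε, HasDerivAt (fun s => ρ (pt s τ)) (Ψ s τ) s := by
      intro s hs
      have hsV := (hA' s τ (by rw [abs_of_nonneg hs.1]; exact hs.2.trans_lt hεm.2) hτ).1.1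
      have hl : HasDerivAt (fun s => pt s τ) ![(p + τ • X) 0, 0] s := by
        rw [hasDerivAt_pi]
        intro j
        fin_cases j
        · simpa [hpt] using ((hasDerivAt_id s).ofReal_comp).mul_const ((p + τ • X) 0)
        · simpa [hpt] using hasDerivAt_const s ((p + τ • X) 1)
      exact HasFDerivAt.comp_hasDerivAt (f := fun s => pt s τ) s
        ((hρ.contDiffAt hsV).differentiableAt (by simp)).hasFDerivAt hl
    obtain ⟨s, hs, h⟩ := exists_hasDerivAt_eq_slope (fun s => ρ (pt s τ)) (fun s => Ψ s τ) hε
      (fun s hs => (hd s hs).continuousAt.continuousWithinAt)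
      (fun s hs => hd s (Set.Ioo_subset_Icc_self hs))
    refine ⟨s, hs, ?_⟩
    rw [h, (hB' τ hτ).1.1]
    field_simp
    ring
  have hεη : 0 < ε ^ η := Real.rpow_pos_of_pos hε η
  have hrpos : ∀ τ : ℂ, ‖τ‖ ≤ δ → 0 < ρ (pt ε τ) := by
    intro τ hτ
    obtain ⟨s, hs, h⟩ := hmv τ hτ
    rw [h]
    exact mul_pos hε (hA' s τ (by rw [abs_of_pos hs.1]; exact hs.2.trans hεm.2) hτ).2
  have hpow : ∀ τ : ℂ, ‖τ‖ ≤ δ → ∃ s : ℝ, |s| < ε₀ ∧ ρ (pt ε τ) ^ η = ε ^ η * Ψ s τ ^ η := by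
    intro τ hτ
    obtain ⟨s, hs, h⟩ := hmv τ hτ
    refine ⟨s, by rw [abs_of_pos hs.1]; exact hs.2.trans hεm.1, ?_⟩
    rw [h, Real.mul_rpow hε.le
      (hA' s τ (by rw [abs_of_pos hs.1]; exact hs.2.trans hεm.2) hτ).2.le]
  have hεV : ∀ τ : ℂ, ‖τ‖ ≤ δ → pt ε τ ∈ V ∧ pt ε τ ∈ W := fun τ hτ =>
    (hA' ε τ (by rw [abs_of_pos hε]; exact hεm.2) hτ).1
  have hsm : ∀ τ : ℂ, ‖τ‖ ≤ δ → ContDiffAt ℝ 2 (fun z => ρ z ^ η) (pt ε τ) := fun τ hτ =>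
    ((hρ.contDiffAt (hεV τ hτ).1).rpow_const_of_ne (hrpos τ hτ).ne').of_le two_le_smooth
  refine no_interior_max (H := fun τ => ρ (pt ε τ) ^ η + -ε ^ η * U (p + τ • X) +
    -ε ^ η * c * Complex.normSq τ) hδ ?_ ?_ ?_
  · intro τ hτ
    rw [mem_closedBall_zero_iff] at hτ
    refine ContinuousAt.continuousWithinAt ?_
    refine ContinuousAt.add (ContinuousAt.add ?_ (continuousAt_const.mul ?_))
      (continuousAt_const.mul Complex.continuous_normSq.continuousAt)
    · exact ContinuousAt.comp (f := fun τ => pt ε τ) (x := τ) (hsm τ hτ).continuousAt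
        (cpt.comp (by fun_prop : Continuous fun τ : ℂ => (ε, τ))).continuousAt
    · exact ContinuousAt.comp (f := fun τ : ℂ => p + τ • X) (x := τ) (hB' τ hτ).2.1.continuousAt
        cl.continuousAt
  · intro τ hτ
    have hτ' := mem_sphere_zero_iff_norm.1 hτ
    obtain ⟨s, hs, h⟩ := hpow τ hτ'.le
    obtain ⟨s', hs', h'⟩ := hpow 0 (by simpa using hδ.le)
    have e1 := (hE (y := s) (by simpa using hs)).1 τ hτ
    have e2 := (hE (y := s') (by simpa using hs')).2
    simp only [h, h', zero_smul, add_zero, map_zero, mul_zero]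
    rw [Complex.normSq_eq_norm_sq, hτ']
    have : ε ^ η * ((Ψ s τ ^ η - U (p + τ • X)) - c * δ ^ 2) < ε ^ η * (Ψ s' 0 ^ η - U p) :=
      mul_lt_mul_of_pos_left (by linarith) hεη
    linarith
  · intro τ hτ
    have hτ' : ‖τ‖ ≤ δ := (mem_ball_zero_iff.1 hτ).le
    set Y : Fin 2 → ℂ := ![ε * X 0, X 1] with hY
    have hline : ∀ v : ℂ, ∀ s : ℝ, pt ε (τ + s * v) = pt ε τ + s • (v • Y) := by
      intro v s
      ext j
      fin_cases j <;> simp [hpt, hY] <;> ring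
    have hline' : ∀ v : ℂ, ∀ s : ℝ, p + (τ + s * v) • X = p + τ • X + s • (v • X) := by
      intro v s
      ext j
      simp
      ring
    have hjet : ∀ v : ℂ, Complex.normSq v = 1 → ∃ a, HasJet (fun s : ℝ => ρ (pt ε (τ + s * v)) ^ η +
        -ε ^ η * U (p + (τ + s * v) • X) + -ε ^ η * c * Complex.normSq (τ + s * v)) a
        (fderiv ℝ (fderiv ℝ fun z => ρ z ^ η) (pt ε τ) (v • Y) (v • Y) +
          -ε ^ η * fderiv ℝ (fderiv ℝ U) (p + τ • X) (v • X) (v • X) + -ε ^ η * c * 2) := by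
      intro v hv
      have j1 := (hsm τ hτ').hasJet (v • Y)
      have j2 := ((HasJet.affine (-ε ^ η) 0).mul ((hB' τ hτ').2.1.hasJet (v • X)))
      obtain ⟨a, j3⟩ := hasJet_normSq_line τ v
      have j4 := (HasJet.affine (-ε ^ η * c) 0).mul j3
      have e1 : (fun s : ℝ => ρ (pt ε (τ + s * v)) ^ η + -ε ^ η * U (p + (τ + s * v) • X) +
          -ε ^ η * c * Complex.normSq (τ + s * v)) = fun s : ℝ => ρ (pt ε τ + s • (v • Y)) ^ η +
          (-ε ^ η + s * 0) * U (p + τ • X + s • (v • X)) +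
          (-ε ^ η * c + s * 0) * Complex.normSq (τ + s * v) := by
        ext s
        simp only [hline, hline', mul_zero, add_zero]
      rw [e1]
      refine ⟨_, (congrArg _ ?_).mp ((j1.add j2).add j4)⟩
      rw [hv]; ring
    obtain ⟨a, h1⟩ := hjet 1 (by simp)
    obtain ⟨a', h2⟩ := hjet Complex.I (by simp)
    refine ⟨a, _, a', _, h1, h2, ?_⟩
    have hYne : Y ≠ 0 := fun h => hX (by simpa [hY] using congrFun h 1)
    have hlev := hpsh (pt ε τ) ⟨fun hcl => (hρ.nonpos_of_mem_closure hcl).not_gt (hrpos τ hτ'),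
      (hεV τ hτ').2⟩ Y hYne
    have h4 := four_mul_levi_re (hsm τ hτ') Y
    have h5 := mul_neg_of_pos_of_neg hεη (hB' τ hτ').2.2
    simp only [hΛ] at h5
    simp only [one_smul]
    linarith

/-- The function `-Re(z e^{-i log|w|²})`, to which the defining function of the worm domain is
asymptotic near the core annulus. -/
def wormLin (q : Fin 2 → ℂ) : ℝ := -(q 0 * Complex.exp (-Complex.I * wormAngle q)).re

lemma wormLin_eq (q : Fin 2 → ℂ) : wormLin q =
    -((q 0).re * Real.cos (wormAngle q) + (q 0).im * Real.sin (wormAngle q)) := by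
  rw [wormLin, exp_neg_I_mul_eq]
  simp

lemma contDiffAt_wormLin {q : Fin 2 → ℂ} (hq : q 1 ≠ 0) :
    ContDiffAt ℝ (⊤ : ℕ∞) wormLin q := by
  have : wormLin = fun q => -(wormRot q + 1).re := by
    ext q; rw [wormRot, sub_add_cancel]; rfl
  rw [this]
  exact (Complex.reCLM.contDiff.contDiffAt.comp q
    ((contDiffAt_wormRot hq).add contDiffAt_const)).neg

lemma hasLevi_wormLin {w x : ℂ} (hw : w ≠ 0) {t : ℝ} (ht : t = Real.log (Complex.normSq w)) :
    HasLevi wormLin ![-Complex.exp (Complex.I * t), w] ![x * Complex.exp (Complex.I * t), w]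
      (-x / 2) (-1 - x.im) := by
  set q : Fin 2 → ℂ := ![-Complex.exp (Complex.I * t), w] with hq
  set X : Fin 2 → ℂ := ![x * Complex.exp (Complex.I * t), w] with hX
  have hq1 : q 1 ≠ 0 := hw
  have hX1 : X 1 / q 1 = 1 := div_self hw
  have hqt : wormAngle q = t := ht.symm
  have h := (((HasLevi.re_coord q X 0).mul (hasLevi_cos_wormAngle hq1 X)).add
    ((HasLevi.im_coord q X 0).mul (hasLevi_sin_wormAngle hq1 X))).neg
  rw [funext wormLin_eq]
  rw [hX1, hqt] at h
  have hX0 : X 0 = x * ⟨Real.cos t, Real.sin t⟩ := by simp [hX, exp_I_mul_eq]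
  have hq0 : q 0 = -⟨Real.cos t, Real.sin t⟩ := by simp [hq, exp_I_mul_eq]
  have hcs := Real.cos_sq_add_sin_sq t
  rw [hX0, hq0] at h
  generalize Real.cos t = C at *
  generalize Real.sin t = S at *
  have hS2 : S ^ 2 = 1 - C ^ 2 := by linarith
  refine h.congr ?_ ?_
  · apply Complex.ext
    · simp
      ring_nf
      simp only [hS2]
      ring
    · simp
      ring_nf
      simp only [hS2]
      ring
  · simp
    ring_nf
    simp only [hS2]
    ring

section Core

variable {φ : ℝ → ℝ} {β : ℝ} {V : Set (Fin 2 → ℂ)} {ρ : (Fin 2 → ℂ) → ℝ} {w : ℂ}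

lemma wormRho_core (hw : φ (Real.log (Complex.normSq w)) = 0) (z : ℂ) :
    wormRho φ ![z, w] = Complex.normSq z -
      2 * (z * Complex.exp (-Complex.I * Real.log (Complex.normSq w))).re := by
  have hw' : φ (wormAngle ![z, w]) = 0 := hw
  rw [wormRho_eq, hw', exp_neg_I_mul_eq]
  show (z.re - _) * _ + (z.im - _) * _ + _ = _
  have := Real.cos_sq_add_sin_sq (wormAngle ![z, w])
  have e : wormAngle ![z, w] = Real.log (Complex.normSq w) := rfl
  rw [e] at this ⊢
  generalize Real.log (Complex.normSq w) = t at *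
  simp [Complex.normSq_apply]
  linear_combination this

lemma eventually_mem_wormDomain (hw0 : w ≠ 0) (hw : φ (Real.log (Complex.normSq w)) = 0) {v : ℂ}
    (hv : 0 < (v * Complex.exp (-Complex.I * Real.log (Complex.normSq w))).re) :
    ∀ᶠ s : ℝ in 𝓝[>] 0, ![s * v, w] ∈ wormDomain φ := by
  set b := (v * Complex.exp (-Complex.I * Real.log (Complex.normSq w))).re with hb
  have h1 : Filter.Tendsto (fun s : ℝ => s * Complex.normSq v) (𝓝[>] 0) (𝓝 0) := by
    have : Continuous fun s : ℝ => s * Complex.normSq v := by fun_prop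
    simpa using (this.tendsto 0).mono_left nhdsWithin_le_nhds
  filter_upwards [self_mem_nhdsWithin, h1.eventually_lt_const (by linarith : 0 < 2 * b)] with s hs h
  refine ⟨hw0, ?_⟩
  rw [wormRho_core hw, mul_assoc, Complex.re_ofReal_mul, map_mul, Complex.normSq_ofReal, ← hb]
  have : s * (s * Complex.normSq v - 2 * b) < 0 :=
    mul_neg_of_pos_of_neg hs (by linarith)
  linarith

lemma core_mem_frontier (hφ : IsWormFunction φ β) (hw0 : w ≠ 0)
    (hw : φ (Real.log (Complex.normSq w)) = 0) : ![0, w] ∈ frontier (wormDomain φ) := by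
  rw [(isOpen_wormDomain hφ.smooth).frontier_eq]
  constructor
  · have h1 := eventually_mem_wormDomain hw0 hw
      (v := Complex.exp (Complex.I * Real.log (Complex.normSq w))) (by
        rw [← Complex.exp_add]; simp)
    refine mem_closure_of_tendsto ?_ h1
    have : Continuous fun s : ℝ => (![s * Complex.exp (Complex.I * Real.log (Complex.normSq w)),
        w] : Fin 2 → ℂ) := by
      refine continuous_pi fun j => ?_
      fin_cases j
      · simp; fun_prop
      · simp; fun_prop
    simpa using (this.tendsto 0).mono_left (nhdsWithin_le_nhds (s := Set.Ioi 0))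
  · rintro ⟨-, h⟩
    rw [wormRho_core hw] at h
    simp at h

/-- The inner normal derivative, up to sign, of a defining function on the core annulus. -/
def coreSlope (ρ : (Fin 2 → ℂ) → ℝ) (w : ℂ) : ℝ :=
  -fderiv ℝ ρ ![0, w] ![Complex.exp (Complex.I * Real.log (Complex.normSq w)), 0]

lemma fderiv_core (hφ : IsWormFunction φ β) (hρ : IsDefFn (wormDomain φ) V ρ) (hw0 : w ≠ 0)
    (hw : φ (Real.log (Complex.normSq w)) = 0) :
    0 ≤ coreSlope ρ w ∧ ∀ v : ℂ, fderiv ℝ ρ ![0, w] ![v, 0] =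
      -coreSlope ρ w * (v * Complex.exp (-Complex.I * Real.log (Complex.normSq w))).re := by
  set t := Real.log (Complex.normSq w) with ht
  have hfr := core_mem_frontier hφ hw0 hw
  have hV := hρ.subset (frontier_subset_closure hfr)
  have hzero := hρ.eq_zero_of_mem_frontier (isOpen_wormDomain hφ.smooth) hfr
  have hle : ∀ v : ℂ, 0 < (v * Complex.exp (-Complex.I * t)).re →
      fderiv ℝ ρ ![0, w] ![v, 0] ≤ 0 := by
    intro v hv
    have hl : HasDerivAt (fun s : ℝ => (![s * v, w] : Fin 2 → ℂ)) ![v, 0] 0 := by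
      rw [hasDerivAt_pi]
      intro j
      fin_cases j
      · simpa using ((hasDerivAt_id (0 : ℝ)).ofReal_comp).mul_const v
      · simpa using hasDerivAt_const (0 : ℝ) w
    have h1 : HasDerivAt (fun s : ℝ => ρ ![s * v, w]) (fderiv ℝ ρ ![0, w] ![v, 0]) 0 := by
      refine HasFDerivAt.comp_hasDerivAt (f := fun s : ℝ => (![s * v, w] : Fin 2 → ℂ)) (0 : ℝ) ?_ hl
      simpa using ((hρ.contDiffAt hV).differentiableAt (by simp)).hasFDerivAt
    refine le_of_tendsto h1.tendsto_slope_zero_right ?_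
    filter_upwards [self_mem_nhdsWithin, eventually_mem_wormDomain hw0 hw hv] with s hs hmem
    rw [hρ.eq] at hmem
    have h2 : ρ ![s * v, w] < 0 := hmem.2
    simp only [zero_add, Complex.ofReal_zero, zero_mul, hzero, sub_zero, smul_eq_mul]
    exact mul_nonpos_of_nonneg_of_nonpos (inv_nonneg.2 (le_of_lt hs)) h2.le
  have hcomb : ∀ x y : ℝ, fderiv ℝ ρ ![0, w] ![(x + y * Complex.I) * Complex.exp (Complex.I * t), 0]
      = -coreSlope ρ w * x +
        y * fderiv ℝ ρ ![0, w] ![Complex.I * Complex.exp (Complex.I * t), 0] := by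
    intro x y
    have : (![(x + y * Complex.I) * Complex.exp (Complex.I * t), 0] : Fin 2 → ℂ) =
        x • ![Complex.exp (Complex.I * t), 0] +
        y • ![Complex.I * Complex.exp (Complex.I * t), 0] := by
      ext j
      fin_cases j
      · simp; ring
      · simp
    rw [this, map_add, map_smul, map_smul, coreSlope]
    simp only [smul_eq_mul]
    ring
  have hre : ∀ x y : ℝ, ((x + y * Complex.I) * Complex.exp (Complex.I * t) *
      Complex.exp (-Complex.I * t)).re = x := by
    intro x y
    rw [mul_assoc, ← Complex.exp_add]; simp
  have hI : fderiv ℝ ρ ![0, w] ![Complex.I * Complex.exp (Complex.I * t), 0] = 0 := by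
    by_contra hne
    set l := fderiv ℝ ρ ![0, w] ![Complex.I * Complex.exp (Complex.I * t), 0]
    have h1 := hle _ (by rw [hre 1 ((coreSlope ρ w + 1) / l)]; norm_num)
    rw [hcomb, div_mul_cancel₀ _ hne] at h1
    linarith
  refine ⟨?_, fun v => ?_⟩
  · have h1 := hle _ (by rw [hre 1 0]; norm_num)
    rw [hcomb] at h1
    linarith
  · have hv := eq_mul_exp v t
    rw [← Complex.re_add_im (v * Complex.exp (-Complex.I * t))] at hv
    conv_lhs => rw [hv]
    rw [hcomb, hI, mul_zero, add_zero]

lemma coreSlope_pos (hφ : IsWormFunction φ β) (hρ : IsDefFn (wormDomain φ) V ρ) (hw0 : w ≠ 0)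
    (hw : ∀ᶠ u in 𝓝 w, φ (Real.log (Complex.normSq u)) = 0) : 0 < coreSlope ρ w := by
  have hfr := core_mem_frontier hφ hw0 hw.self_of_nhds
  have hV := hρ.subset (frontier_subset_closure hfr)
  obtain ⟨h1, h2⟩ := fderiv_core hφ hρ hw0 hw.self_of_nhds
  refine lt_of_le_of_ne h1 fun h0 => hρ.grad_ne _ hfr ?_
  ext Y
  have hY : Y = ![Y 0, 0] + ![0, Y 1] := by
    ext j; fin_cases j <;> simp
  have hl : HasDerivAt (fun s : ℝ => (![0, w + s * Y 1] : Fin 2 → ℂ)) ![0, Y 1] 0 := by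
    rw [hasDerivAt_pi]
    intro j
    fin_cases j
    · simpa using hasDerivAt_const (0 : ℝ) (0 : ℂ)
    · simpa using (((hasDerivAt_id (0 : ℝ)).ofReal_comp).mul_const (Y 1)).const_add w
  have h3 : HasDerivAt (fun s : ℝ => ρ ![0, w + s * Y 1]) (fderiv ℝ ρ ![0, w] ![0, Y 1]) 0 := by
    refine HasFDerivAt.comp_hasDerivAt (f := fun s : ℝ => (![0, w + s * Y 1] : Fin 2 → ℂ))
      (0 : ℝ) ?_ hl
    simpa using ((hρ.contDiffAt hV).differentiableAt (by simp)).hasFDerivAt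
  have h4 : (fun s : ℝ => ρ ![0, w + s * Y 1]) =ᶠ[𝓝 0] fun _ => 0 := by
    have hc : Filter.Tendsto (fun s : ℝ => w + s * Y 1) (𝓝 0) (𝓝 w) := by
      have : Continuous fun s : ℝ => w + s * Y 1 := by fun_prop
      simpa using this.tendsto 0
    filter_upwards [hc.eventually hw, hc.eventually (isOpen_ne.mem_nhds hw0)] with s hs hs'
    exact hρ.eq_zero_of_mem_frontier (isOpen_wormDomain hφ.smooth) (core_mem_frontier hφ hs' hs)
  have h5 : fderiv ℝ ρ ![0, w] ![0, Y 1] = 0 := by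
    rw [← h3.deriv, h4.deriv_eq]; simp
  rw [hY, map_add, h5, h2, ← h0]
  simp

end Core

section LowerBound

variable {φ : ℝ → ℝ} {β η : ℝ} {V : Set (Fin 2 → ℂ)} {ρ : (Fin 2 → ℂ) → ℝ}

lemma continuousAt_coreSlope (hρ : IsDefFn (wormDomain φ) V ρ) {w : ℂ} (hw : w ≠ 0)
    (hV : ![0, w] ∈ V) : ContinuousAt (coreSlope ρ) w := by
  have h1 : Continuous fun u : ℂ => (![0, u] : Fin 2 → ℂ) := by
    refine continuous_pi fun j => ?_
    fin_cases j
    · exact continuous_const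
    · exact continuous_id
  have h2 : ContinuousAt (fun u : ℂ => fderiv ℝ ρ ![0, u]) w :=
    ContinuousAt.comp (f := fun u : ℂ => (![0, u] : Fin 2 → ℂ)) (g := fderiv ℝ ρ)
      (hρ.continuousAt_fderiv hV) h1.continuousAt
  have hlog : ContinuousAt (fun u : ℂ => Real.log (Complex.normSq u)) w :=
    Complex.continuous_normSq.continuousAt.log (by simpa using hw)
  have h3 : ContinuousAt (fun u : ℂ => (![Complex.exp (Complex.I * Real.log (Complex.normSq u)), 0] :
      Fin 2 → ℂ)) w := by
    refine continuousAt_pi.2 fun j => ?_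
    fin_cases j
    · exact (continuousAt_const.mul (Complex.continuous_ofReal.continuousAt.comp hlog)).cexp
    · exact continuousAt_const
  exact (h2.clm_apply h3).neg

/-- The closed core annulus `|log|w|²| ≤ T` is compact. -/
lemma isCompact_annulus (T : ℝ) :
    IsCompact {w : ℂ | w ≠ 0 ∧ |Real.log (Complex.normSq w)| ≤ T} := by
  have e : {w : ℂ | w ≠ 0 ∧ |Real.log (Complex.normSq w)| ≤ T} =
      Complex.normSq ⁻¹' Set.Icc (Real.exp (-T)) (Real.exp T) := by
    ext w
    simp only [Set.mem_ofPred_eq, Set.mem_preimage, Set.mem_Icc, abs_le]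
    constructor
    · rintro ⟨h, h1, h2⟩
      have := Complex.normSq_pos.2 h
      exact ⟨(Real.le_log_iff_exp_le this).1 h1, (Real.log_le_iff_le_exp this).1 h2⟩
    · rintro ⟨h1, h2⟩
      have := (Real.exp_pos _).trans_le h1
      exact ⟨Complex.normSq_pos.1 this, (Real.le_log_iff_exp_le this).2 h1,
        (Real.log_le_iff_le_exp this).2 h2⟩
  rw [e]
  refine Metric.isCompact_of_isClosed_isBounded
    (isClosed_Icc.preimage Complex.continuous_normSq) ?_
  refine (Metric.isBounded_closedBall (x := (0 : ℂ)) (r := Real.sqrt (Real.exp T))).subset ?_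
  intro w hw
  rw [mem_closedBall_zero_iff]
  refine Real.le_sqrt_of_sq_le ?_
  rw [← Complex.normSq_eq_norm_sq]
  exact hw.2

/-- A maximum of the core slope weighted by a power of the cosine is attained in the interior
of the core annulus. -/
lemma exists_max_coreSlope (hφ : IsWormFunction φ β) (hβ : Real.pi / 2 < β)
    (hρ : IsDefFn (wormDomain φ) V ρ) {κ s : ℝ} (hs : 0 < s)
    (hκ : κ * (β - Real.pi / 2) = Real.pi / 2) :
    ∃ w₀ M, w₀ ≠ 0 ∧ |Real.log (Complex.normSq w₀)| < β - Real.pi / 2 ∧ 0 < M ∧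
      coreSlope ρ w₀ = M * Real.exp (-s * Real.log (Real.cos (κ * Real.log (Complex.normSq w₀)))) ∧
      ∀ w, w ≠ 0 → |Real.log (Complex.normSq w)| < β - Real.pi / 2 →
        coreSlope ρ w ≤
          M * Real.exp (-s * Real.log (Real.cos (κ * Real.log (Complex.normSq w)))) := by
  set T := β - Real.pi / 2 with hT
  have hT0 : 0 < T := by rw [hT]; linarith
  have hκ0 : 0 < κ := by
    by_contra! h
    nlinarith [Real.pi_pos]
  have hcos : ∀ t, |t| < T → 0 < Real.cos (κ * t) := fun t ht => cos_mul_pos hκ0 hκ.le ht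
  set f : ℂ → ℝ := fun w =>
    coreSlope ρ w * Real.cos (κ * Real.log (Complex.normSq w)) ^ s with hf
  have hcont : ContinuousOn f {w : ℂ | w ≠ 0 ∧ |Real.log (Complex.normSq w)| ≤ T} := by
    rintro w ⟨hw, ht⟩
    have hfr := core_mem_frontier hφ hw ((hφ.eq_zero_iff).2 ht)
    have hlog : ContinuousAt (fun u : ℂ => Real.log (Complex.normSq u)) w :=
      Complex.continuous_normSq.continuousAt.log (by simpa using hw)
    refine ((continuousAt_coreSlope hρ hw (hρ.subset (frontier_subset_closure hfr))).mul
      (ContinuousAt.rpow_const ?_ (Or.inr hs.le))).continuousWithinAt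
    exact Real.continuous_cos.continuousAt.comp (continuousAt_const.mul hlog)
  obtain ⟨w₀, ⟨hw0, ht0⟩, hmax⟩ := (isCompact_annulus T).exists_isMaxOn
    ⟨1, one_ne_zero, by simpa using hT0.le⟩ hcont
  have h1 : 0 < f w₀ := by
    have h2 : f 1 ≤ f w₀ := hmax ⟨one_ne_zero, by simpa using hT0.le⟩
    have h3 : 0 < coreSlope ρ 1 := by
      refine coreSlope_pos hφ hρ one_ne_zero ?_
      have hlog : ContinuousAt (fun u : ℂ => |Real.log (Complex.normSq u)|) 1 :=
        (Complex.continuous_normSq.continuousAt.log (by simp)).abs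
      filter_upwards [hlog.eventually_lt continuousAt_const (by simpa using hT0)] with u hu
      exact hφ.eq_zero_iff.2 hu.le
    have h4 : f 1 = coreSlope ρ 1 := by simp [hf]
    linarith
  have hrpow : ∀ t, |t| < T →
      Real.cos (κ * t) ^ s * Real.exp (-s * Real.log (Real.cos (κ * t))) = 1 := by
    intro t ht
    rw [Real.rpow_def_of_pos (hcos t ht), ← Real.exp_add]
    ring_nf
    simp
  have ht0' : |Real.log (Complex.normSq w₀)| < T := by
    refine lt_of_le_of_ne ht0 fun h => h1.ne' ?_
    have : Real.cos (κ * Real.log (Complex.normSq w₀)) = 0 := by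
      rw [← Real.cos_abs, abs_mul, h, abs_of_pos hκ0, hκ, Real.cos_pi_div_two]
    simp only [hf]
    rw [this, Real.zero_rpow hs.ne', mul_zero]
  refine ⟨w₀, f w₀, hw0, ht0', h1, ?_, fun w hw ht => ?_⟩
  · simp only [hf]
    rw [mul_assoc, hrpow _ ht0', mul_one]
  · have h2 : f w ≤ f w₀ := hmax ⟨hw, ht.le⟩
    calc coreSlope ρ w = f w *
        Real.exp (-s * Real.log (Real.cos (κ * Real.log (Complex.normSq w)))) := by
          simp only [hf]
          rw [mul_assoc, hrpow _ ht, mul_one]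
      _ ≤ _ := mul_le_mul_of_nonneg_right h2 (Real.exp_pos _).le

lemma fderiv_core_eq_wormLin (hφ : IsWormFunction φ β) (hρ : IsDefFn (wormDomain φ) V ρ)
    {q : Fin 2 → ℂ} (hq : q 1 ≠ 0) (ht : φ (wormAngle q) = 0) :
    fderiv ℝ ρ ![0, q 1] ![q 0, 0] = coreSlope ρ (q 1) * wormLin q := by
  rw [(fderiv_core hφ hρ hq ht).2, wormLin, wormAngle]
  ring

/-- The model function `(M·wormLin·e^g)^η` is not subharmonic along a suitable complex line when
`(η - 1) g'' < η (g'^2 + 1)`. -/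
lemma exists_direction_neg {M : ℝ} (hM : 0 < M) (hη : 1 < η) {w : ℂ} (hw : w ≠ 0) {g : ℝ → ℝ}
    (hg : ContDiffAt ℝ (⊤ : ℕ∞) g (Real.log (Complex.normSq w)))
    (hlt : (η - 1) * deriv (deriv g) (Real.log (Complex.normSq w)) <
      η * (deriv g (Real.log (Complex.normSq w)) ^ 2 + 1)) :
    ∃ x : ℂ, ∀ p X : Fin 2 → ℂ,
      p = ![-Complex.exp (Complex.I * Real.log (Complex.normSq w)), w] →
      X = ![x * Complex.exp (Complex.I * Real.log (Complex.normSq w)), w] →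
      wormLin p = 1 ∧
      ContDiffAt ℝ (⊤ : ℕ∞) (fun q => (M * wormLin q * Real.exp (g (wormAngle q))) ^ η) p ∧
      fderiv ℝ (fderiv ℝ (fun q => (M * wormLin q * Real.exp (g (wormAngle q))) ^ η)) p X X +
        fderiv ℝ (fderiv ℝ (fun q => (M * wormLin q * Real.exp (g (wormAngle q))) ^ η)) p
          (Complex.I • X) (Complex.I • X) < 0 := by
  set t := Real.log (Complex.normSq w) with ht
  set a := deriv g t with ha
  have hη1 : 0 < η - 1 := by linarith
  refine ⟨⟨2 * (η * a) / (η - 1), 2 / (η - 1)⟩, ?_⟩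
  set x : ℂ := ⟨2 * (η * a) / (η - 1), 2 / (η - 1)⟩ with hx
  intro p X hp hX
  have hp1 : p 1 = w := by rw [hp]; rfl
  have hX1 : X 1 / p 1 = 1 := by rw [hp, hX]; exact div_self hw
  have hq : p 1 ≠ 0 := by rw [hp1]; exact hw
  have hpt : wormAngle p = t := by rw [wormAngle, hp1]
  have hL1 : wormLin p = 1 := by
    rw [wormLin, hpt, hp]
    simp [← Complex.exp_add]
  have hLpos : 0 < M * wormLin p := by rw [hL1]; linarith
  have hsm : ContDiffAt ℝ (⊤ : ℕ∞)
      (fun q => (M * wormLin q * Real.exp (g (wormAngle q))) ^ η) p := by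
    refine ContDiffAt.rpow_const_of_ne ?_ (mul_pos hLpos (Real.exp_pos _)).ne'
    refine (contDiffAt_const.mul (contDiffAt_wormLin hq)).mul (ContDiffAt.exp ?_)
    exact ContDiffAt.comp p (by rw [hpt]; exact hg) (contDiffAt_wormAngle hq)
  refine ⟨hL1, hsm, ?_⟩
  have h1 : HasLevi wormLin p X (-x / 2) (-1 - x.im) := by
    rw [hp, hX]; exact hasLevi_wormLin hw ht
  have hM1 : HasLevi (fun q => M * wormLin q) p X (M * (-x / 2)) (M * (-1 - x.im)) :=
    ((HasLevi.const M p X).mul h1).congr (by simp) (by simp)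
  obtain ⟨d', h2⟩ := hM1.mul_exp_rpow hq
    (by rw [hpt]; exact hg.of_le two_le_smooth) hLpos η
  rw [h2.second_eq (hsm.of_le two_le_smooth), hX1, hpt, hL1]
  refine mul_neg_of_pos_of_neg (by norm_num) (mul_neg_of_pos_of_neg ?_ ?_)
  · exact mul_pos (mul_pos (by linarith)
      (Real.rpow_pos_of_pos (mul_pos (by linarith) (Real.exp_pos _)) _)) (by positivity)
  · have hre : x.re = 2 * (η * a) / (η - 1) := rfl
    have him : x.im = 2 / (η - 1) := rfl
    have hn : Complex.normSq (-x / 2) = (x.re ^ 2 + x.im ^ 2) / 4 := by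
      rw [Complex.normSq_apply]; simp; ring
    have hr : (-x / 2).re = -x.re / 2 := by simp
    have e : M * 1 * (M * (-1 - x.im)) + 2 * η * (M * 1) * a *
        ((M : ℂ) * (-x / 2) * (starRingEnd ℂ) 1).re +
        (M * 1) ^ 2 * (deriv (deriv g) t + η * a ^ 2) * Complex.normSq 1 +
        (η - 1) * Complex.normSq ((M : ℂ) * (-x / 2)) =
        M ^ 2 / (η - 1) * ((η - 1) * deriv (deriv g) t - η * (a ^ 2 + 1)) := by
      rw [map_one, mul_one ((M : ℂ) * _), map_one, Complex.re_ofReal_mul, Complex.normSq_mul,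
        Complex.normSq_ofReal, hn, hr, hre, him]
      field_simp
      ring
    rw [e]
    exact mul_neg_of_pos_of_neg (by positivity) (sub_neg.2 hlt)

lemma le_of_mem_steinExpSet (hφ : IsWormFunction φ β) (hβ : Real.pi / 2 < β)
    (hρ : IsDefFn (wormDomain φ) V ρ) (hη : η ∈ steinExpSet (wormDomain φ) ρ) :
    Real.pi ≤ 2 * η * (Real.pi - β) := by
  obtain ⟨hη1, W, hW, hfW, hpsh⟩ := hη
  by_contra! hcon
  have hT : 0 < β - Real.pi / 2 := by linarith
  have hη0 : 0 < η := by linarith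
  set κ := Real.pi / 2 / (β - Real.pi / 2) with hκdef
  have hκ : κ * (β - Real.pi / 2) = Real.pi / 2 := div_mul_cancel₀ _ hT.ne'
  have hκ0 : 0 < κ := div_pos (by linarith [Real.pi_pos]) hT
  set s := (η - 1) / η with hs
  have hs0 : 0 < s := div_pos (by linarith) hη0
  have hκη : κ * (η - 1) < η := by
    rw [hκdef, div_mul_eq_mul_div, div_lt_iff₀ hT]; linarith
  obtain ⟨w₀, M, hw0, ht0, hM, heq, hle⟩ := exists_max_coreSlope hφ hβ hρ hs0 hκ
  have hcos : Real.cos (κ * Real.log (Complex.normSq w₀)) ≠ 0 := (cos_mul_pos hκ0 hκ.le ht0).ne'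
  set g : ℝ → ℝ := fun t => -s * Real.log (Real.cos (κ * t)) with hg
  have hgs : ContDiffAt ℝ (⊤ : ℕ∞) g (Real.log (Complex.normSq w₀)) := contDiffAt_log_cos hcos
  obtain ⟨hg1, hg2⟩ := deriv_log_cos (s := s) hcos
  obtain ⟨x, hx⟩ := exists_direction_neg hM hη1 hw0 hgs (by
    rw [hg1, hg2]
    set c := Real.tan (κ * Real.log (Complex.normSq w₀))
    have e1 : η * ((s * κ * c) ^ 2 + 1) - (η - 1) * (s * κ ^ 2 * (1 + c ^ 2)) =
        (η ^ 2 - (κ * (η - 1)) ^ 2) / η := by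
      rw [hs]; field_simp; ring
    have e2 : 0 < (η ^ 2 - (κ * (η - 1)) ^ 2) / η := by
      refine div_pos ?_ hη0
      have : 0 < κ * (η - 1) := mul_pos hκ0 (by linarith)
      nlinarith
    linarith)
  set p : Fin 2 → ℂ := ![-Complex.exp (Complex.I * Real.log (Complex.normSq w₀)), w₀] with hp
  set X : Fin 2 → ℂ := ![x * Complex.exp (Complex.I * Real.log (Complex.normSq w₀)), w₀] with hX
  obtain ⟨hL1, hsm, hneg⟩ := hx p X rfl rfl
  have hp1 : p 1 ≠ 0 := hw0
  have hpt : |wormAngle p| < β - Real.pi / 2 := ht0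
  have hfr := core_mem_frontier hφ hp1 (hφ.eq_zero_iff.2 hpt.le)
  have hline : Filter.Tendsto (fun τ : ℂ => p + τ • X) (𝓝 0) (𝓝 p) := by
    have : Continuous fun τ : ℂ => p + τ • X := by fun_prop
    simpa using this.tendsto 0
  have hnear : ∀ᶠ q in 𝓝 p, q 1 ≠ 0 ∧ |wormAngle q| < β - Real.pi / 2 ∧ 0 < wormLin q := by
    filter_upwards [isOpen_ne_zero.mem_nhds hp1,
      (contDiffAt_wormAngle hp1).continuousAt.abs.eventually_lt continuousAt_const hpt,
      continuousAt_const.eventually_lt (contDiffAt_wormLin hp1).continuousAt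
        (by rw [hL1]; exact one_pos)] with q h1 h2 h3 using ⟨h1, h2, h3⟩
  have hslope := fderiv_core_eq_wormLin hφ hρ hp1 (hφ.eq_zero_iff.2 hpt.le)
  have hpeq : fderiv ℝ ρ ![0, p 1] ![p 0, 0] =
      M * wormLin p * Real.exp (g (wormAngle p)) := by
    rw [hslope, hL1, mul_one, mul_one]; exact heq
  refine not_strictPSHOn_of_model hρ hW hη0 hpsh (p := p) (X := X) hw0 hsm hneg
    (hρ.subset (frontier_subset_closure hfr)) (hfW hfr) ?_ ?_ (by rw [hpeq]) ?_
  · filter_upwards [hline.eventually hnear] with τ hτ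
    exact hρ.eq_zero_of_mem_frontier (isOpen_wormDomain hφ.smooth)
      (core_mem_frontier hφ hτ.1 (hφ.eq_zero_iff.2 hτ.2.1.le))
  · filter_upwards [hline.eventually hnear] with τ ⟨h1, h2, h3⟩
    have h4 := fderiv_core hφ hρ h1 (hφ.eq_zero_iff.2 h2.le)
    rw [fderiv_core_eq_wormLin hφ hρ h1 (hφ.eq_zero_iff.2 h2.le)]
    refine Real.rpow_le_rpow (mul_nonneg h4.1 h3.le) ?_ hη0.le
    rw [mul_right_comm]
    exact mul_le_mul_of_nonneg_right (hle _ h1 h2) h3.le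
  · rw [hpeq, hL1]
    positivity

end LowerBound

/-- Theorem 5.3: the Steinness index of the worm domain `Ω_β` is
`π/(2(π−β))` for `π/2 < β < π` and `∞` for `β ≥ π`. -/
theorem steinIndex_wormDomain (β : ℝ) (hβ : Real.pi / 2 < β) (φ : ℝ → ℝ)
    (hφ : IsWormFunction φ β) :
    (β < Real.pi →
      steinIndex (wormDomain φ) = ENNReal.ofReal (Real.pi / (2 * (Real.pi - β)))) ∧
    (Real.pi ≤ β → steinIndex (wormDomain φ) = ⊤) := by
  constructor
  · intro hβ'
    refine le_antisymm (steinIndex_wormDomain_le hφ hβ hβ') ?_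
    refine le_iInf fun V => le_iInf fun ρ => le_iInf fun hρ => le_sInf ?_
    rintro _ ⟨η, hη, rfl⟩
    refine ENNReal.ofReal_le_ofReal ((div_le_iff₀ (by linarith)).2 ?_)
    linarith [le_of_mem_steinExpSet hφ hβ hρ hη]
  · intro hβ'
    refine top_le_iff.1 (le_iInf fun V => le_iInf fun ρ => le_iInf fun hρ => le_sInf ?_)
    rintro _ ⟨η, hη, rfl⟩
    have h1 := le_of_mem_steinExpSet hφ hβ hρ hη
    have h2 : 2 * η * (Real.pi - β) ≤ 0 :=
      mul_nonpos_of_nonneg_of_nonpos (by linarith [hη.1]) (by linarith)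
    linarith [Real.pi_pos]
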